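/- Let B_t = R/I_t(φ) be standard determinantal of codimension c = 3 with J := I_{t−1}(φ), M = coker(φ*), and ℓ₃ := Σ_{j=1}^{t+2} a_j − Σ_{i=1}^{t} b_i. If depth_J B_t ≥ 5, then Tor_1^R(M, M) ≅ S₂M ⊗_R I_t(φ) ≅ Ext²_R(I_t(φ), I_t(φ))(−ℓ₃) as graded R-modules. -/

import Mathlib

/-!
Common setup for formalizing "Schur powers of the cokernel of a graded morphism"
by J.O. Kleppe and R.M. Miró-Roig.
-/

open Matrix TensorProduct CategoryTheory

noncomputable section

namespace KMR

/-- The standard graded polynomial ring `R = k[x₀,…,xₙ]`. -/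
abbrev RR (k : Type) [Field k] (n : ℕ) : Type := MvPolynomial (Fin (n + 1)) k

variable {k : Type} [Field k] {n : ℕ}

/-- The irrelevant maximal ideal `𝔪 = (x₀,…,xₙ)`. -/
def mxI (k : Type) [Field k] (n : ℕ) : Ideal (RR k n) :=
  Ideal.span (Set.range MvPolynomial.X)

/-- The ideal `I_j(A)` generated by the `j × j` minors of the matrix `A`. -/
def minors {g t : ℕ} (A : Matrix (Fin g) (Fin t) (RR k n)) (j : ℕ) : Ideal (RR k n) :=
  Ideal.span {m | ∃ (r : Fin j → Fin g) (c : Fin j → Fin t),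
    Function.Injective r ∧ Function.Injective c ∧ m = (A.submatrix r c).det}

/-- The matrix `A` represents a graded morphism `φ : F = ⊕ R(bⱼ) → G = ⊕ R(aᵢ)`,
i.e. each entry `A i j` is homogeneous of degree `aᵢ - bⱼ` (or zero). -/
def IsHomogMatrix {g t : ℕ} (A : Matrix (Fin g) (Fin t) (RR k n))
    (a : Fin g → ℤ) (b : Fin t → ℤ) : Prop :=
  ∀ i j, A i j = 0 ∨ ∃ d : ℕ, (d : ℤ) = a i - b j ∧ (A i j).IsHomogeneous d

/-- The morphism `φ` is minimal, i.e. `φ(F) ⊆ 𝔪 G`: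
all entries of a representing matrix have vanishing constant term. -/
def IsMinMatrix {g t : ℕ} (A : Matrix (Fin g) (Fin t) (RR k n)) : Prop :=
  ∀ i j, MvPolynomial.constantCoeff (A i j) = 0

/-- `depthGE J N d` : there is an `N`-regular sequence of length `d` inside `J`,
i.e. `depth_J N ≥ d`. -/
def depthGE {R : Type} [CommRing R] (J : Ideal R) (N : Type) [AddCommGroup N] [Module R N]
    (d : ℕ) : Prop :=
  ∃ rs : List R, rs.length = d ∧ (∀ x ∈ rs, x ∈ J) ∧ RingTheory.Sequence.IsRegular N rs

/-- `depthEQ J N d` : the length of a maximal `N`-regular sequence in `J` is exactly `d`. -/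
def depthEQ {R : Type} [CommRing R] (J : Ideal R) (N : Type) [AddCommGroup N] [Module R N]
    (d : ℕ) : Prop :=
  depthGE J N d ∧ ¬ depthGE J N (d + 1)

/-- The morphism `φ : F → G` of free modules represented by the matrix `A`. -/
def phi {g t : ℕ} (A : Matrix (Fin g) (Fin t) (RR k n)) :
    (Fin t → RR k n) →ₗ[RR k n] (Fin g → RR k n) := A.mulVecLin

/-- The dual morphism `φ* : G* → F*`, represented by the transposed matrix. -/
def phiStar {g t : ℕ} (A : Matrix (Fin g) (Fin t) (RR k n)) :
    (Fin g → RR k n) →ₗ[RR k n] (Fin t → RR k n) := A.transpose.mulVecLin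

/-- `M = coker (φ*)`. -/
abbrev Mdl {g t : ℕ} (A : Matrix (Fin g) (Fin t) (RR k n)) : Type :=
  (Fin t → RR k n) ⧸ LinearMap.range (phiStar A)

/-- The canonical projection `F* → M = coker φ*`. -/
def MdlProj {g t : ℕ} (A : Matrix (Fin g) (Fin t) (RR k n)) :
    (Fin t → RR k n) →ₗ[RR k n] Mdl A :=
  Submodule.mkQ _

/-- The `i`-th symmetric power of a module, as a quotient of the `i`-th tensor power. -/
abbrev SymPow (R : Type) [CommRing R] (M : Type) [AddCommGroup M] [Module R M] (i : ℕ) : Type :=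
  (⨂[R]^i M) ⧸ Submodule.span R
    {z | ∃ (σ : Equiv.Perm (Fin i)) (f : Fin i → M),
      z = PiTensorProduct.tprod R f - PiTensorProduct.tprod R (f ∘ σ)}

section ExtPow

variable {R M N : Type} [CommRing R] [AddCommGroup M] [Module R M]
  [AddCommGroup N] [Module R N]

lemma extPow_map_mem (p : ℕ) (f : M →ₗ[R] N) {x : ExteriorAlgebra R M}
    (hx : x ∈ ⋀[R]^p M) : ExteriorAlgebra.map f x ∈ ⋀[R]^p N := by
  rw [← ExteriorAlgebra.ιMulti_span_fixedDegree] at hx ⊢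
  induction hx using Submodule.span_induction with
  | mem x h =>
      obtain ⟨v, rfl⟩ := h
      rw [ExteriorAlgebra.map_apply_ιMulti]
      exact Submodule.subset_span ⟨_, rfl⟩
  | zero => simpa using Submodule.zero_mem _
  | add x y _ _ h1 h2 => simpa using Submodule.add_mem _ h1 h2
  | smul r x _ h => simpa using Submodule.smul_mem _ r h

/-- The induced map `⋀^p M → ⋀^p N` of a linear map `f : M → N`. -/
def extPowMap (p : ℕ) (f : M →ₗ[R] N) : (⋀[R]^p M) →ₗ[R] (⋀[R]^p N) :=
  (ExteriorAlgebra.map f).toLinearMap.restrict (fun _ hx => extPow_map_mem p f hx)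

end ExtPow

section Wedge

variable (R L : Type) [CommRing R] [AddCommGroup L] [Module R L]

/-- Auxiliary map `L ⊗ L → Λ(L)`, `x ⊗ y ↦ ι x * ι y`. -/
def wedgeToAlg : L ⊗[R] L →ₗ[R] ExteriorAlgebra R L :=
  (LinearMap.mul' R (ExteriorAlgebra R L)).comp
    (TensorProduct.map (ExteriorAlgebra.ι R) (ExteriorAlgebra.ι R))

lemma wedgeToAlg_mem (z : L ⊗[R] L) : wedgeToAlg R L z ∈ ⋀[R]^2 L := by
  induction z using TensorProduct.induction_on with
  | zero => simpa using Submodule.zero_mem _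
  | tmul x y =>
      have : wedgeToAlg R L (x ⊗ₜ[R] y) =
          ExteriorAlgebra.ι R x * ExteriorAlgebra.ι R y := by
        simp [wedgeToAlg]
      have h2 : (⋀[R]^2 L) =
          LinearMap.range (ExteriorAlgebra.ι R (M := L)) *
            LinearMap.range (ExteriorAlgebra.ι R (M := L)) := pow_two _
      rw [this, h2]
      exact Submodule.mul_mem_mul (LinearMap.mem_range_self _ x) (LinearMap.mem_range_self _ y)
  | add x y h1 h2 => simpa using Submodule.add_mem _ h1 h2

/-- The wedge product map `L ⊗ L → ⋀² L`, `x ⊗ y ↦ x ∧ y`. -/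
def wedge2 : L ⊗[R] L →ₗ[R] (⋀[R]^2 L) :=
  (wedgeToAlg R L).codRestrict _ (wedgeToAlg_mem R L)

end Wedge

section ExtTor

variable (R : Type) [CommRing R]

/-- `Ext^i_R(M, N)` as an object of `ModuleCat R` (via the derived functor `Ext`). -/
abbrev ExtM (i : ℕ) (M N : Type) [AddCommGroup M] [Module R M] [AddCommGroup N] [Module R N] :
    ModuleCat R :=
  ((Ext R (ModuleCat R) i).obj (Opposite.op (ModuleCat.of R M))).obj (ModuleCat.of R N)

/-- `Tor_i^R(M, N)` as an object of `ModuleCat R` (via the derived functor `Tor`). -/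
abbrev TorM (i : ℕ) (M N : Type) [AddCommGroup M] [Module R M] [AddCommGroup N] [Module R N] :
    ModuleCat R :=
  ((Tor (ModuleCat R) i).obj (ModuleCat.of R M)).obj (ModuleCat.of R N)

/-- Isomorphism of `R`-modules, stated for objects of `ModuleCat R`. -/
def misoM {R : Type} [CommRing R] (X Y : ModuleCat R) : Prop := Nonempty (X ≅ Y)

end ExtTor

section Schur

/-- The cells of the Young diagram whose `r`-th row has length `lens r`. -/
abbrev YoungCells (m : ℕ) (lens : Fin m → ℕ) : Type := Σ r : Fin m, Fin (lens r)

variable (R M : Type) [CommRing R] [AddCommGroup M] [Module R M]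

/-- The action of a permutation of the index set on a tensor power. -/
def permAct {ι : Type} [Fintype ι] (σ : Equiv.Perm ι) :
    (⨂[R] _ : ι, M) →ₗ[R] (⨂[R] _ : ι, M) :=
  (PiTensorProduct.reindex R (fun _ : ι => M) σ).toLinearMap

open scoped Classical in
/-- The Young symmetrizer attached to the Young diagram with row lengths `lens`:
`e = Σ_{σ ∈ RowStab} Σ_{τ ∈ ColStab} sgn(τ) • (σ τ)` acting on the tensor power of `M`
indexed by the cells of the diagram.  (We work in characteristic zero, where its image
is the Schur power `Σ^I M` for the partition `I` with conjugate row lengths `lens`.) -/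
def youngSymmetrizer (m : ℕ) (lens : Fin m → ℕ) :
    (⨂[R] _ : YoungCells m lens, M) →ₗ[R] (⨂[R] _ : YoungCells m lens, M) :=
  ∑ σ : Equiv.Perm (YoungCells m lens), ∑ τ : Equiv.Perm (YoungCells m lens),
    if (∀ x, (σ x).1 = x.1) ∧ (∀ x, ((τ x).2 : ℕ) = ((x.2 : ℕ))) then
      ((Equiv.Perm.sign τ : ℤ) • permAct R M (σ * τ))
    else 0

/-- The Schur power `Σ^I M` of `M`, for the partition `I` whose Young diagram has
row lengths `lens` (read as a Young diagram; rows of the diagram of `I`). -/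
abbrev SchurPow (m : ℕ) (lens : Fin m → ℕ) : Type :=
  ↥(LinearMap.range (youngSymmetrizer R M m lens))

end Schur

section SymZ

variable {g t : ℕ} (A : Matrix (Fin g) (Fin t) (RR k n))

/-- Auxiliary: `SZ A 0 = Hom_R(M, R/I_t(A)) = S_{-1}M` and `SZ A (m+1) = S_m M`. -/
def SZ : ℕ → Type
  | 0 => Mdl A →ₗ[RR k n] (RR k n ⧸ minors A t)
  | (m + 1) => SymPow (RR k n) (Mdl A) m

instance : ∀ m, AddCommGroup (SZ A m)
  | 0 => inferInstanceAs (AddCommGroup (Mdl A →ₗ[RR k n] (RR k n ⧸ minors A t)))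
  | (m + 1) => inferInstanceAs (AddCommGroup (SymPow (RR k n) (Mdl A) m))

instance : ∀ m, Module (RR k n) (SZ A m)
  | 0 => inferInstanceAs (Module (RR k n) (Mdl A →ₗ[RR k n] (RR k n ⧸ minors A t)))
  | (m + 1) => inferInstanceAs (Module (RR k n) (SymPow (RR k n) (Mdl A) m))

/-- `S_i M` for `i ∈ ℤ`, `i ≥ -1`:  `SymZ A (-1) = Hom(M, B_t)` and `SymZ A i = S_i M`
for `i ≥ 0` (junk value `Hom(M, B_t)` for `i < -1`). -/
abbrev SymZ (i : ℤ) : Type := SZ A (i + 1).toNat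

end SymZ

section IdealTransform

variable {R : Type} [CommRing R] (J : Ideal R)
variable (N : Type) [AddCommGroup N] [Module R N]

/-- `Hom_R(Jᵛ, N)`. -/
abbrev homPow (ν : ℕ) : Type := ↥(J ^ ν) →ₗ[R] N

/-- Restriction `Hom(Jᵛ, N) → Hom(Jᵘ, N)` along `Jᵘ ⊆ Jᵛ` for `ν ≤ μ`. -/
def homPowMap (ν μ : ℕ) (h : ν ≤ μ) : homPow J N ν →ₗ[R] homPow J N μ :=
  LinearMap.lcomp R N (Submodule.inclusion (Ideal.pow_le_pow_right h))

/-- The ideal transform `D_J(N) = colim_ν Hom_R(Jᵛ, N)`.  By Deligne's formula this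
computes `H⁰_*(U, Ñ)` for `U` the complement of `V(J)`. -/
abbrev IdealTransform : Type := Module.DirectLimit (homPow J N) (homPowMap J N)

end IdealTransform

/-- A homogeneous ideal of `R = k[x₀,…,xₙ]`. -/
def IsHomogIdeal (I : Ideal (RR k n)) : Prop :=
  ∀ f ∈ I, ∀ d : ℕ, MvPolynomial.homogeneousComponent d f ∈ I

/-- The identity element of `V ⊗ V*` for the free module `V = R^m` (both `V` and its
dual realized as `Fin m → R`). -/
def idElem (R : Type) [CommRing R] (m : ℕ) : (Fin m → R) ⊗[R] (Fin m → R) :=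
  ∑ i : Fin m, (Pi.single i 1) ⊗ₜ[R] (Pi.single i 1)

end KMR

namespace KMR

/-- Extension of a projective presentation of length two to a chain complex. -/
def resComplex {R : Type} [CommRing R] {X₀ X₁ X₂ : ModuleCat.{0} R} (d₀ : X₁ ⟶ X₀) (d₁ : X₂ ⟶ X₁)
    (h : d₁ ≫ d₀ = 0) : ChainComplex (ModuleCat.{0} R) ℕ :=
  ChainComplex.mk X₀ X₁ X₂ d₀ d₁ h (fun S => ⟨Projective.over (Limits.kernel S.f),
    Projective.π _ ≫ Limits.kernel.ι S.f,
    by rw [Category.assoc, Limits.kernel.condition, Limits.comp_zero]⟩)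

lemma exact_proj_kernel {R : Type} [CommRing R] {X Y : ModuleCat.{0} R} (f : X ⟶ Y) :
    (ShortComplex.mk (Projective.π (Limits.kernel f) ≫ Limits.kernel.ι f) f (by simp)).Exact :=
  exact_d_f f

section Resolution

variable {R : Type} [CommRing R] {X₀ X₁ X₂ : ModuleCat.{0} R} (d₀ : X₁ ⟶ X₀) (d₁ : X₂ ⟶ X₁)
    (h : d₁ ≫ d₀ = 0)

lemma resComplex_d_1_0 : (resComplex d₀ d₁ h).d 1 0 = d₀ := ChainComplex.mk_d_1_0 ..

lemma resComplex_d_2_1 : (resComplex d₀ d₁ h).d 2 1 = d₁ := ChainComplex.mk_d_2_1 ..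

lemma resComplex_exactAt_succ (hex : (ShortComplex.mk d₁ d₀ h).Exact) (n : ℕ) :
    (resComplex d₀ d₁ h).ExactAt (n + 1) := by
  rw [HomologicalComplex.exactAt_iff' _ (n + 1 + 1) (n + 1) n (by simp) (by simp)]
  change (ShortComplex.mk _ _ ((resComplex d₀ d₁ h).d_comp_d (n + 2) (n + 1) n)).Exact
  rw [resComplex, ← ChainComplex.mkAux_eq_shortComplex_mk_d_comp_d]
  cases n with
  | zero => exact hex
  | succ n => exact exact_proj_kernel _

instance [Projective X₀] [Projective X₁] [Projective X₂] (n : ℕ) :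
    Projective ((resComplex d₀ d₁ h).X n) := by
  obtain (_ | _ | _ | n) := n
  · assumption
  · assumption
  · assumption
  · apply Projective.projective_over
  

end Resolution

section Resolution

variable {R : Type} [CommRing R] {X₀ X₁ X₂ Z : ModuleCat.{0} R} (d₀ : X₁ ⟶ X₀) (d₁ : X₂ ⟶ X₁)
    (h : d₁ ≫ d₀ = 0)

/-- The projective resolution extending a projective presentation of length two. -/
def resOf [Projective X₀] [Projective X₁] [Projective X₂] (p : X₀ ⟶ Z) [Epi p]
    (hp : d₀ ≫ p = 0) (hex₀ : (ShortComplex.mk d₀ p hp).Exact)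
    (hex : (ShortComplex.mk d₁ d₀ h).Exact) : ProjectiveResolution Z where
  complex := resComplex d₀ d₁ h
  π := (ChainComplex.toSingle₀Equiv (resComplex d₀ d₁ h) Z).symm
    ⟨p, by rw [resComplex_d_1_0]; exact hp⟩
  quasiIso := ⟨fun n => by
    cases n
    · rw [ChainComplex.quasiIsoAt₀_iff, ShortComplex.quasiIso_iff_of_zeros']
      · refine (ShortComplex.exact_and_epi_g_iff_of_iso (S₂ := ShortComplex.mk d₀ p hp) ?_).2
          ⟨hex₀, by assumption⟩
        exact ShortComplex.isoMk (Iso.refl _) (Iso.refl _) (Iso.refl _)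
          ((Category.id_comp d₀).trans ((resComplex_d_1_0 d₀ d₁ h).symm.trans
            (Category.comp_id ((resComplex d₀ d₁ h).d 1 0)).symm))
          ((Category.id_comp p).trans ((ChainComplex.toSingle₀Equiv_symm_apply_f_zero
            (C := resComplex d₀ d₁ h) p (by rw [resComplex_d_1_0]; exact hp)).symm.trans
            (Category.comp_id _).symm))
      · exact (resComplex d₀ d₁ h).shape 0 0 (by simp)
      · exact HomologicalComplex.single_obj_d (ComplexShape.down ℕ) ..
      · exact HomologicalComplex.single_obj_d (ComplexShape.down ℕ) ..
    · rw [quasiIsoAt_iff_exactAt']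
      · exact resComplex_exactAt_succ _ _ _ hex _
      · apply ChainComplex.exactAt_succ_single_obj⟩

lemma tor_iso_of_map_eq_zero [Projective X₀] [Projective X₁] [Projective X₂] (p : X₀ ⟶ Z) [Epi p]
    (hp : d₀ ≫ p = 0) (hex₀ : (ShortComplex.mk d₀ p hp).Exact)
    (hex : (ShortComplex.mk d₁ d₀ h).Exact) (F : ModuleCat.{0} R ⥤ ModuleCat.{0} R) [F.Additive]
    (hF : F.map d₁ = 0) :
    Nonempty ((F.leftDerived 1).obj Z ≅ Limits.kernel (F.map d₀)) := by
  let P := resOf d₀ d₁ h p hp hex₀ hex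
  refine ⟨P.isoLeftDerivedObj F 1 ≪≫ ?_⟩
  let K := (F.mapHomologicalComplex _).obj P.complex
  let S := ShortComplex.mk (F.map d₁) (F.map d₀) (by rw [hF, Limits.zero_comp])
  let e : K.sc' 2 1 0 ≅ S := ShortComplex.isoMk (Iso.refl _) (Iso.refl _) (Iso.refl _)
    ((Category.id_comp (F.map d₁)).trans ((congrArg F.map (resComplex_d_2_1 d₀ d₁ h)).symm.trans
            (Category.comp_id (F.map ((resComplex d₀ d₁ h).d 2 1))).symm))
    ((Category.id_comp (F.map d₀)).trans ((congrArg F.map (resComplex_d_1_0 d₀ d₁ h)).symm.trans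
            (Category.comp_id (F.map ((resComplex d₀ d₁ h).d 1 0))).symm))
  exact ShortComplex.homologyMapIso (K.isoSc' 2 1 0 (by simp) (by simp) ≪≫ e) ≪≫
    (ShortComplex.LeftHomologyData.ofHasKernel S hF).homologyIso

lemma ext_iso_of_mono [Projective X₀] [Projective X₁] [Projective X₂] (p : X₀ ⟶ Z) [Epi p]
    (hp : d₀ ≫ p = 0) (hex₀ : (ShortComplex.mk d₀ p hp).Exact)
    (hex : (ShortComplex.mk d₁ d₀ h).Exact) [Mono d₁] (N : ModuleCat.{0} R) :
    Nonempty (((Ext R (ModuleCat.{0} R) 2).obj (Opposite.op Z)).obj N ≅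
      Limits.cokernel (((linearYoneda R (ModuleCat.{0} R)).obj N).map d₁.op)) := by
  let P := resOf d₀ d₁ h p hp hex₀ hex
  refine ⟨P.isoExt (R := R) 2 N ≪≫ ?_⟩
  let K := P.complex.linearYonedaObj R N
  let G := (linearYoneda R (ModuleCat.{0} R)).obj N
  have key : ∀ {W : ModuleCat.{0} R} (f : W ⟶ X₂), f ≫ d₁ = 0 → f = 0 :=
    fun f => Limits.zero_of_comp_mono d₁
  have h3 : P.complex.d 3 2 = 0 := by
    have : P.complex.d 3 2 ≫ d₁ = 0 := by
      have h4 := P.complex.d_comp_d 3 2 1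
      rwa [show P.complex.d 2 1 = d₁ from resComplex_d_2_1 d₀ d₁ h] at h4
    exact key _ this
  let δ : P.complex.X 3 ⟶ X₂ := P.complex.d 3 2
  have h4 : G.map δ.op = 0 := by
    rw [show δ = 0 from h3]
    exact G.map_zero _ _
  let S := ShortComplex.mk (G.map d₁.op) (G.map δ.op) (by
    rw [h4, Limits.comp_zero])
  let e : K.sc' 1 2 3 ≅ S := ShortComplex.isoMk (Iso.refl _) (Iso.refl _) (Iso.refl _)
    ((Category.id_comp (G.map d₁.op)).trans
      ((congrArg (fun x => G.map (Quiver.Hom.op x)) (resComplex_d_2_1 d₀ d₁ h)).symm.trans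
            (Category.comp_id (G.map ((resComplex d₀ d₁ h).d 2 1).op)).symm))
    ((Category.id_comp (G.map (P.complex.d 3 2).op)).trans 
            (Category.comp_id (G.map (P.complex.d 3 2).op)).symm)
  exact ShortComplex.homologyMapIso (K.isoSc' 1 2 3 (by simp) (by simp) ≪≫ e) ≪≫
    (ShortComplex.RightHomologyData.ofHasCokernel S h4).homologyIso

end Resolution

section Modules

variable {R : Type} [CommRing R] {P₀ P₁ P₂ Z : Type} [AddCommGroup P₀] [Module R P₀]
  [AddCommGroup P₁] [Module R P₁] [AddCommGroup P₂] [Module R P₂] [AddCommGroup Z] [Module R Z]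
  [Module.Projective R P₀] [Module.Projective R P₁] [Module.Projective R P₂]
  (d₁ : P₂ →ₗ[R] P₁) (d₀ : P₁ →ₗ[R] P₀) (p : P₀ →ₗ[R] Z)

lemma tor_one_iso (hp : Function.Surjective p) (hex₀ : Function.Exact d₀ p)
    (hex : Function.Exact d₁ d₀) (X : Type) [AddCommGroup X] [Module R X]
    (hX : LinearMap.lTensor X d₁ = 0) :
    misoM (TorM R 1 X Z) (ModuleCat.of R (LinearMap.ker (LinearMap.lTensor X d₀))) := by
  have hepi : Epi (ModuleCat.ofHom p) := (ModuleCat.epi_iff_surjective _).2 hp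
  obtain ⟨e⟩ := tor_iso_of_map_eq_zero (ModuleCat.ofHom d₀) (ModuleCat.ofHom d₁)
    (by ext x; exact hex.apply_apply_eq_zero x) (ModuleCat.ofHom p)
    (by ext x; exact hex₀.apply_apply_eq_zero x)
    ((ShortComplex.ShortExact.moduleCat_exact_iff_function_exact _).2 hex₀)
    ((ShortComplex.ShortExact.moduleCat_exact_iff_function_exact _).2 hex)
    ((MonoidalCategory.tensoringLeft (ModuleCat.{0} R)).obj (ModuleCat.of R X))
    (by
      change ModuleCat.ofHom (LinearMap.lTensor X d₁) = 0
      rw [hX]; rfl)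
  exact ⟨e ≪≫ ModuleCat.kernelIsoKer _⟩

lemma ext_two_iso (hp : Function.Surjective p) (hex₀ : Function.Exact d₀ p)
    (hex : Function.Exact d₁ d₀) (hd : Function.Injective d₁) (N : Type) [AddCommGroup N]
    [Module R N] :
    misoM (ExtM R 2 Z N)
      (ModuleCat.of R ((P₂ →ₗ[R] N) ⧸ LinearMap.range (LinearMap.lcomp R N d₁))) := by
  have hepi : Epi (ModuleCat.ofHom p) := (ModuleCat.epi_iff_surjective _).2 hp
  have hmono : Mono (ModuleCat.ofHom d₁) := (ModuleCat.mono_iff_injective _).2 hd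
  obtain ⟨e⟩ := ext_iso_of_mono (ModuleCat.ofHom d₀) (ModuleCat.ofHom d₁)
    (by ext x; exact hex.apply_apply_eq_zero x) (ModuleCat.ofHom p)
    (by ext x; exact hex₀.apply_apply_eq_zero x)
    ((ShortComplex.ShortExact.moduleCat_exact_iff_function_exact _).2 hex₀)
    ((ShortComplex.ShortExact.moduleCat_exact_iff_function_exact _).2 hex) (ModuleCat.of R N)
  refine ⟨e ≪≫ ModuleCat.cokernelIsoRangeQuotient _ ≪≫ LinearEquiv.toModuleIso ?_⟩
  refine Submodule.Quotient.equiv _ _ ModuleCat.homLinearEquiv ?_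
  ext f
  constructor
  · rintro ⟨_, ⟨g, rfl⟩, rfl⟩
    exact ⟨g.hom, rfl⟩
  · rintro ⟨g, rfl⟩
    exact ⟨_, ⟨ModuleCat.ofHom g, rfl⟩, rfl⟩

end Modules

section Depth

open scoped Pointwise

variable {R : Type} [CommRing R] (J : Ideal R)

/-- The module `Ext^i(R/J, N)`. -/
abbrev ExtQ (N : Type) [AddCommGroup N] [Module R N] (i : ℕ) : Type :=
  Abelian.Ext (ModuleCat.of R (R ⧸ J)) (ModuleCat.of R N) i

/-- Vanishing of `Ext^i(R/J, N)` for `i < d`. -/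
def Dep (d : ℕ) (N : Type) [AddCommGroup N] [Module R N] : Prop :=
  ∀ i < d, Subsingleton (ExtQ J N i)

variable {N N' N'' : Type} [AddCommGroup N'] [Module R N'] [AddCommGroup N''] [Module R N'']
  [AddCommGroup N] [Module R N]

/-- Functoriality of `Ext^i(R/J, -)`. -/
def push (i : ℕ) (f : N →ₗ[R] N') : ExtQ J N i →ₗ[R] ExtQ J N' i where
  toFun x := x.comp (Abelian.Ext.mk₀ (ModuleCat.ofHom f)) (add_zero i)
  map_add' x y := by simp
  map_smul' r x := by simp

variable {J}

lemma push_push (i : ℕ) (f : N →ₗ[R] N') (g : N' →ₗ[R] N'') (x : ExtQ J N i) :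
    push J i g (push J i f x) = push J i (g ∘ₗ f) x := by
  simp [push]

lemma push_id (i : ℕ) (x : ExtQ J N i) : push J i LinearMap.id x = x := by
  simp [push]

lemma push_zero (i : ℕ) (x : ExtQ J N i) : push J i (0 : N →ₗ[R] N') x = 0 := by
  simp [push]

lemma push_add (i : ℕ) (f g : N →ₗ[R] N') (x : ExtQ J N i) :
    push J i (f + g) x = push J i f x + push J i g x := by
  simp [push, Abelian.Ext.mk₀_add]

lemma push_smul (i : ℕ) (r : R) (f : N →ₗ[R] N') (x : ExtQ J N i) :
    push J i (r • f) x = r • push J i f x := by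
  have h : ModuleCat.ofHom (r • f) = r • ModuleCat.ofHom f := rfl
  simp [push, h, Abelian.Ext.mk₀_smul]

lemma push_sum (i : ℕ) {ι : Type} (s : Finset ι) (f : ι → N →ₗ[R] N') (x : ExtQ J N i) :
    push J i (∑ a ∈ s, f a) x = ∑ a ∈ s, push J i (f a) x := by
  classical
  induction s using Finset.induction_on with
  | empty => simp [push_zero]
  | insert a s ha ih => rw [Finset.sum_insert ha, push_add, ih, Finset.sum_insert ha]

lemma smul_extQ_eq_zero (i : ℕ) {r : R} (hr : r ∈ J) (x : ExtQ J N i) : r • x = 0 := by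
  have h0 : (r • 𝟙 (ModuleCat.of R (R ⧸ J))) = 0 := by
    ext
    change r • (1 : R ⧸ J) = 0
    rw [Algebra.smul_def, mul_one]
    exact Ideal.Quotient.eq_zero_iff_mem.2 hr
  have h1 : r • x = (Abelian.Ext.mk₀ (r • 𝟙 (ModuleCat.of R (R ⧸ J)))).comp x (zero_add i) := by
    rw [Abelian.Ext.mk₀_smul, Abelian.Ext.smul_comp, Abelian.Ext.mk₀_id_comp]
  rw [h1, h0, Abelian.Ext.mk₀_zero, Abelian.Ext.zero_comp]

variable {f : N →ₗ[R] N'} {g : N' →ₗ[R] N''}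

section ShortExact

variable (hf : Function.Injective f) (hg : Function.Surjective g) (h : Function.Exact f g)
include hf hg h

lemma shortExact_of_linear : (ModuleCat.shortComplexOfCompEqZero f g
    h.linearMap_comp_eq_zero).ShortExact :=
  ModuleCat.shortComplex_shortExact _ h hf hg

lemma push_injective (i : ℕ) (hs : Subsingleton (ExtQ J N'' i)) :
    Function.Injective (push J (i + 1) f) := by
  rw [injective_iff_map_eq_zero]
  intro x hx
  obtain ⟨y, rfl⟩ := Abelian.Ext.covariant_sequence_exact₁ _ (shortExact_of_linear hf hg h) x hx rfl
  have : y = 0 := Subsingleton.elim (α := ExtQ J N'' i) _ _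
  rw [this, Abelian.Ext.zero_comp]

lemma push_surjective (i : ℕ) (hs : Subsingleton (ExtQ J N (i + 1))) :
    Function.Surjective (push J i g) := by
  intro x
  exact Abelian.Ext.covariant_sequence_exact₃ _ (shortExact_of_linear hf hg h) x rfl
    (Subsingleton.elim (α := ExtQ J N (i + 1)) _ _)

lemma Dep.coker {d : ℕ} (h1 : Dep J d N') (h2 : Dep J (d + 1) N) : Dep J d N'' := fun i hi =>
  have := h1 i hi
  (push_surjective hf hg h i (h2 _ (by lia))).subsingleton

lemma Dep.ker {d : ℕ} (h1 : Dep J (d + 1) N') (h2 : Dep J d N'') : Dep J (d + 1) N := by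
  intro i hi
  have := h1 i hi
  cases i with
  | zero =>
    refine Function.Injective.subsingleton (f := push J 0 f) ?_
    have : Mono (ModuleCat.ofHom f) := (ModuleCat.mono_iff_injective _).2 hf
    exact Abelian.Ext.postcomp_mk₀_injective_of_mono _ (ModuleCat.ofHom f)
  | succ i => exact (push_injective hf hg h i (h2 i (by lia))).subsingleton

end ShortExact

lemma Dep.mono {d e : ℕ} (h : Dep J d N) (he : e ≤ d) : Dep J e N := fun i hi => h i (by lia)

lemma Dep.retract {d : ℕ} (h : Dep J d N') (f : N →ₗ[R] N') (g : N' →ₗ[R] N)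
    (hfg : g ∘ₗ f = LinearMap.id) : Dep J d N := fun i hi => by
  have := h i hi
  refine Function.Injective.subsingleton (f := push J i f) (Function.LeftInverse.injective
    (g := push J i g) fun x => ?_)
  rw [push_push, hfg, push_id]

lemma Dep.equiv {d : ℕ} (h : Dep J d N') (e : N ≃ₗ[R] N') : Dep J d N :=
  h.retract e.toLinearMap e.symm.toLinearMap (by ext; simp)

lemma Dep.pi {d : ℕ} {ι : Type} [Fintype ι] (h : Dep J d N) : Dep J d (ι → N) := fun i hi => by
  classical
  have := h i hi
  refine subsingleton_of_forall_eq 0 fun x => ?_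
  have h1 : (LinearMap.id : (ι → N) →ₗ[R] (ι → N)) =
      ∑ a, (LinearMap.single R (fun _ => N) a) ∘ₗ LinearMap.proj a := by
    ext a y b
    simp [Pi.single_apply]
  rw [← push_id i x, h1, push_sum]
  refine Finset.sum_eq_zero fun a _ => ?_
  rw [← push_push, Subsingleton.elim (push J i (LinearMap.proj a) x) 0, map_zero]

lemma Dep.matrix {d : ℕ} {m n : Type} [Fintype m] [Fintype n] (h : Dep J d N) :
    Dep J d (Matrix m n N) :=
  Dep.pi (N := n → N) (Dep.pi h)

lemma Dep.prod {d : ℕ} (h : Dep J d N) (h' : Dep J d N') : Dep J d (N × N') := fun i hi => by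
  have := h i hi
  have := h' i hi
  refine subsingleton_of_forall_eq 0 fun x => ?_
  have h1 : (LinearMap.id : (N × N') →ₗ[R] (N × N')) =
      LinearMap.inl R N N' ∘ₗ LinearMap.fst R N N' +
        LinearMap.inr R N N' ∘ₗ LinearMap.snd R N N' := by
    ext <;> simp
  rw [← push_id i x, h1, push_add, ← push_push, ← push_push,
    Subsingleton.elim (push J i (LinearMap.fst R N N') x) 0,
    Subsingleton.elim (push J i (LinearMap.snd R N N') x) 0, map_zero, map_zero, add_zero]

lemma Dep.eq_zero_of_smul (h : Dep J 1 N) (z : N) (hz : ∀ x ∈ J, x • z = 0) : z = 0 := by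
  have := h 0 one_pos
  let φ : (R ⧸ J) →ₗ[R] N := Submodule.liftQ J (LinearMap.toSpanSingleton R N z) hz
  have h1 : ModuleCat.ofHom φ = 0 :=
    (Abelian.Ext.mk₀_eq_zero_iff _).1 (Subsingleton.elim (α := ExtQ J N 0) _ _)
  have h2 := congrArg (fun f => f.hom (1 : R ⧸ J)) h1
  have h3 : φ (Submodule.Quotient.mk 1) = 0 := h2
  have h4 : φ (Submodule.Quotient.mk 1) = LinearMap.toSpanSingleton R N z 1 :=
    Submodule.liftQ_apply J _ 1
  rwa [h3, LinearMap.toSpanSingleton_apply, one_smul, eq_comm] at h4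

lemma Dep.of_regular_cons {d : ℕ} {x : R} (hx : x ∈ J) (hreg : IsSMulRegular N x)
    (h : Dep J d (QuotSMulTop x N)) : Dep J (d + 1) N := by
  have hf : Function.Injective (LinearMap.lsmul R N x) := hreg
  have hg : Function.Surjective (x • (⊤ : Submodule R N)).mkQ := Submodule.mkQ_surjective _
  have hfg : Function.Exact (LinearMap.lsmul R N x) (x • (⊤ : Submodule R N)).mkQ := by
    rw [LinearMap.exact_iff, Submodule.ker_mkQ]
    ext y
    simp [Submodule.mem_smul_pointwise_iff_exists]
  have h0 : ∀ i (y : ExtQ J N i), push J i (LinearMap.lsmul R N x) y = 0 := fun i y => by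
    have : LinearMap.lsmul R N x = x • LinearMap.id := rfl
    rw [this, push_smul, push_id, smul_extQ_eq_zero i hx]
  intro i hi
  refine subsingleton_of_forall_eq 0 fun y => ?_
  cases i with
  | zero =>
    have : Mono (ModuleCat.ofHom (LinearMap.lsmul R N x)) := (ModuleCat.mono_iff_injective _).2 hf
    exact Abelian.Ext.postcomp_mk₀_injective_of_mono _ (ModuleCat.ofHom (LinearMap.lsmul R N x))
      ((h0 0 y).trans (h0 0 0).symm)
  | succ i =>
    exact push_injective hf hg hfg i (h i (by lia)) ((h0 _ y).trans (h0 _ 0).symm)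

lemma Dep.of_isWeaklyRegular (rs : List R) : ∀ (N : Type) [AddCommGroup N] [Module R N],
    (∀ x ∈ rs, x ∈ J) → RingTheory.Sequence.IsWeaklyRegular N rs → Dep J rs.length N := by
  induction rs with
  | nil => exact fun N _ _ _ _ i hi => absurd hi (by simp)
  | cons x rs ih =>
    intro N _ _ hJ hreg
    rw [RingTheory.Sequence.isWeaklyRegular_cons_iff] at hreg
    exact Dep.of_regular_cons (hJ x (by simp)) hreg.1
      (ih _ (fun y hy => hJ y (by simp [hy])) hreg.2)

lemma Dep.of_depthGE {d : ℕ} (h : depthGE J N d) : Dep J d N := by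
  obtain ⟨rs, rfl, h1, h2⟩ := h
  exact Dep.of_isWeaklyRegular rs N h1 h2.toIsWeaklyRegular

lemma Dep.eq_zero_of_pow [IsNoetherianRing R] (h : Dep J 1 N) {s : Set R} (hs : J = Ideal.span s)
    (z : N) (hz : ∀ x ∈ s, ∃ e : ℕ, x ^ e • z = 0) : z = 0 := by
  have hrad : J ≤ Ideal.radical (LinearMap.ker (LinearMap.toSpanSingleton R N z)) := by
    rw [hs, Ideal.span_le]
    intro x hx
    obtain ⟨e, he⟩ := hz x hx
    exact ⟨e, by simpa using he⟩
  obtain ⟨e, he⟩ := Ideal.exists_pow_le_of_le_radical_of_fg hrad (IsNoetherian.noetherian J)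
  have key : ∀ e : ℕ, (∀ y ∈ J ^ e, y • z = 0) → z = 0 := by
    intro e
    induction e with
    | zero => intro h0; simpa using h0 1 (by simp)
    | succ e ih =>
      intro h0
      refine ih fun y hy => h.eq_zero_of_smul _ fun x hx => ?_
      rw [smul_smul]
      exact h0 _ (by rw [pow_succ']; exact Ideal.mul_mem_mul hx hy)
  exact key e fun y hy => by simpa using he hy

variable [IsNoetherianRing R] {s : Set R}

lemma Dep.exact_of_torsion (hs : J = Ideal.span s) (hc : ∀ x, g (f x) = 0)
    (h : Dep J 1 (N' ⧸ LinearMap.range f))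
    (ht : ∀ z, g z = 0 → ∀ x ∈ s, ∃ e : ℕ, x ^ e • z ∈ LinearMap.range f) :
    Function.Exact f g := by
  intro z
  refine ⟨fun hz => ?_, ?_⟩
  · change z ∈ LinearMap.range f
    rw [← Submodule.Quotient.mk_eq_zero]
    refine h.eq_zero_of_pow hs _ fun x hx => ?_
    obtain ⟨e, he⟩ := ht z hz x hx
    exact ⟨e, by rwa [← Submodule.Quotient.mk_smul, Submodule.Quotient.mk_eq_zero]⟩
  · rintro ⟨x, rfl⟩
    exact hc x

omit [IsNoetherianRing R] in
lemma Dep.coker_range {d : ℕ} (hfg : Function.Exact f g) (h0 : Dep J d N'')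
    (h1 : Dep J (d + 1) (N' ⧸ LinearMap.range f)) : Dep J d (N'' ⧸ LinearMap.range g) := by
  have hk : LinearMap.range f = LinearMap.ker g := (LinearMap.exact_iff.1 hfg).symm
  let φ : (N' ⧸ LinearMap.range f) →ₗ[R] N'' := Submodule.liftQ _ g hk.le
  have hφ : Function.Injective φ := by
    rw [← LinearMap.ker_eq_bot, Submodule.ker_liftQ, ← hk, Submodule.mkQ_map_self]
  have hr : LinearMap.range φ = LinearMap.range g := Submodule.range_liftQ _ _ _
  exact Dep.coker (f := φ) (g := (LinearMap.range g).mkQ) hφ (Submodule.mkQ_surjective _)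
    (by rw [LinearMap.exact_iff, Submodule.ker_mkQ, hr]) h0 h1

lemma Dep.acyclic_step {d : ℕ} (hs : J = Ideal.span s) (hc : ∀ x, g (f x) = 0)
    (h0 : Dep J d N'') (h1 : Dep J (d + 1) (N' ⧸ LinearMap.range f))
    (ht : ∀ z, g z = 0 → ∀ x ∈ s, ∃ e : ℕ, x ^ e • z ∈ LinearMap.range f) :
    Function.Exact f g ∧ Dep J d (N'' ⧸ LinearMap.range g) :=
  have he := Dep.exact_of_torsion hs hc (h1.mono (by lia)) ht
  ⟨he, Dep.coker_range he h0 h1⟩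

lemma Dep.acyclic_start {d : ℕ} (hs : J = Ideal.span s) 
    (h0 : Dep J d N'') (h1 : Dep J (d + 1) N')
    (ht : ∀ z, g z = 0 → ∀ x ∈ s, ∃ e : ℕ, x ^ e • z = 0) :
    Function.Injective g ∧ Dep J d (N'' ⧸ LinearMap.range g) := by
  have hg : Function.Injective g := (injective_iff_map_eq_zero g).2 fun z hz =>
    (h1.mono (by lia)).eq_zero_of_pow hs z (ht z hz)
  exact ⟨hg, Dep.coker (f := g) (g := (LinearMap.range g).mkQ) hg (Submodule.mkQ_surjective _)
    (by rw [LinearMap.exact_iff, Submodule.ker_mkQ]) h0 h1⟩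

end Depth

section Determinants

set_option linter.unusedSectionVars false

variable {R : Type} [CommRing R] {n : Type} [Fintype n] [DecidableEq n]
  (A : Matrix (n ⊕ Fin 2) n R)

/-- The transpose of `A` bordered by two unit rows. -/
def bord (i j : n ⊕ Fin 2) : Matrix (n ⊕ Fin 2) (n ⊕ Fin 2) R :=
  Matrix.of (Sum.elim Aᵀ ![Pi.single i 1, Pi.single j 1])

/-- The maximal minor of `A` complementary to the rows `i`, `j`. -/
def mm (i j : n ⊕ Fin 2) : R := (bord A i j).det

/-- The submaximal minor of `A` complementary to the rows `i`, `j`, `k` and the column `l`. -/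
def nn (l : n) (i j k : n ⊕ Fin 2) : R :=
  ((bord A i j).updateRow (Sum.inl l) (Pi.single k 1)).det

/-- The minor of `A` complementary to the rows `i`, `j`, `k`, `h` and the columns `p`, `l`. -/
def nn2 (p l : n) (i j k h : n ⊕ Fin 2) : R :=
  if l = p then 0 else
  (((bord A i j).updateRow (Sum.inl p) (Pi.single k 1)).updateRow (Sum.inl l) (Pi.single h 1)).det

lemma bord_inl (i j : n ⊕ Fin 2) (l : n) : bord A i j (Sum.inl l) = fun h => A h l := rfl
lemma bord_inr_zero (i j : n ⊕ Fin 2) : bord A i j (Sum.inr 0) = Pi.single i 1 := rfl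
lemma bord_inr_one (i j : n ⊕ Fin 2) : bord A i j (Sum.inr 1) = Pi.single j 1 := rfl

lemma det_updateRow_eq (B : Matrix (n ⊕ Fin 2) (n ⊕ Fin 2) R) (c : n ⊕ Fin 2) (v : n ⊕ Fin 2 → R) :
    (B.updateRow c v).det = ∑ h, v h * (B.updateRow c (Pi.single h 1)).det := by
  simp only [← Matrix.cramer_transpose_apply]
  conv_lhs => rw [pi_eq_sum_univ' v]
  rw [map_sum, Finset.sum_apply]
  refine Finset.sum_congr rfl fun h _ => ?_
  rw [map_smul, Pi.smul_apply, smul_eq_mul]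

lemma bord_updateRow_zero (i j k : n ⊕ Fin 2) :
    (bord A i j).updateRow (Sum.inr 0) (Pi.single k 1) = bord A k j := by
  ext (a | a) b
  · rw [Matrix.updateRow_ne (by simp)]; rfl
  · fin_cases a
    · exact congrFun (Matrix.updateRow_self) b
    · exact congrFun (Matrix.updateRow_ne (by simp)) b

lemma bord_updateRow_one (i j k : n ⊕ Fin 2) :
    (bord A i j).updateRow (Sum.inr 1) (Pi.single k 1) = bord A i k := by
  ext (a | a) b
  · rw [Matrix.updateRow_ne (by simp)]; rfl
  · fin_cases a
    · exact congrFun (Matrix.updateRow_ne (by simp)) b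
    · exact congrFun (Matrix.updateRow_self) b

lemma mm_self (i : n ⊕ Fin 2) : mm A i i = 0 :=
  Matrix.det_zero_of_row_eq (i := Sum.inr 0) (j := Sum.inr 1) (by simp) rfl

lemma det_swap_rows (B B' : Matrix (n ⊕ Fin 2) (n ⊕ Fin 2) R) (a b : n ⊕ Fin 2) (hab : a ≠ b)
    (h1 : B' a = B b) (h2 : B' b = B a) (h3 : ∀ c, c ≠ a → c ≠ b → B' c = B c) :
    B'.det = - B.det := by
  have : B' = B.submatrix (Equiv.swap a b) id := by
    ext c d
    by_cases hca : c = a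
    · subst hca; simp [h1]
    · by_cases hcb : c = b
      · subst hcb; simp [h2]
      · simp [h3 c hca hcb, Equiv.swap_apply_of_ne_of_ne hca hcb]
  rw [this, Matrix.det_permute, Equiv.Perm.sign_swap hab]
  simp

lemma mm_swap (i j : n ⊕ Fin 2) : mm A j i = - mm A i j :=
  det_swap_rows _ _ (Sum.inr 0) (Sum.inr 1) (by simp) rfl rfl (by
    rintro (c | c) h1 h2
    · rfl
    · fin_cases c <;> simp_all)

lemma nn_swap₁₂ (l : n) (i j k : n ⊕ Fin 2) : nn A l j i k = - nn A l i j k := by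
  refine det_swap_rows _ _ (Sum.inr 0) (Sum.inr 1) (by simp) ?_ ?_ ?_
  · simp [bord_inr_zero, bord_inr_one]
  · simp [bord_inr_zero, bord_inr_one]
  · rintro (c | c) h1 h2
    · by_cases h : c = l
      · subst h; simp
      · simp [h, bord_inl]
    · fin_cases c <;> simp_all

lemma nn_swap₂₃ (l : n) (i j k : n ⊕ Fin 2) : nn A l i k j = - nn A l i j k := by
  refine det_swap_rows _ _ (Sum.inl l) (Sum.inr 1) (by simp) ?_ ?_ ?_
  · simp [bord_inr_one]
  · simp [bord_inr_one]
  · rintro (c | c) h1 h2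
    · have h : c ≠ l := fun h => h1 (by rw [h])
      simp [h, bord_inl]
    · fin_cases c
      · simp [bord_inr_zero]
      · simp_all

lemma nn_self₂₃ (l : n) (i j : n ⊕ Fin 2) : nn A l i j j = 0 :=
  Matrix.det_zero_of_row_eq (i := Sum.inl l) (j := Sum.inr 1) (by simp) (by simp [bord_inr_one])

lemma nn_self₁₂ (l : n) (i j : n ⊕ Fin 2) : nn A l i i j = 0 :=
  Matrix.det_zero_of_row_eq (i := Sum.inr 0) (j := Sum.inr 1) (by simp)
    (by simp [bord_inr_one, bord_inr_zero])

lemma nn_self₁₃ (l : n) (i j : n ⊕ Fin 2) : nn A l i j i = 0 :=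
  Matrix.det_zero_of_row_eq (i := Sum.inl l) (j := Sum.inr 0) (by simp) (by simp [bord_inr_zero])

lemma nn_cycle (l : n) (i j k : n ⊕ Fin 2) : nn A l j k i = nn A l i j k := by
  rw [nn_swap₂₃, nn_swap₁₂, neg_neg]

/-- The columns of `A` are annihilated by the matrix of maximal minors. -/
lemma sum_mul_mm (l : n) (j : n ⊕ Fin 2) : ∑ h, A h l * mm A h j = 0 := by
  have := det_updateRow_eq (bord A j j) (Sum.inr 0) (fun h => A h l)
  simp only [bord_updateRow_zero] at this
  refine this.symm.trans (Matrix.det_zero_of_row_eq (i := Sum.inl l) (j := Sum.inr 0) (by simp) ?_)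
  simp [bord_inl]

lemma sum_mul_nn (l l' : n) (i j : n ⊕ Fin 2) :
    ∑ h, A h l' * nn A l i j h = if l' = l then mm A i j else 0 := by
  refine (det_updateRow_eq (bord A i j) (Sum.inl l) (fun h => A h l')).symm.trans ?_
  split_ifs with h
  · subst h
    rw [← bord_inl A i j, Matrix.updateRow_eq_self]; rfl
  · exact Matrix.det_zero_of_row_eq (i := Sum.inl l) (j := Sum.inl l') (by simpa using Ne.symm h)
      (by simp [h, bord_inl])

lemma sum_nn_mul (i j h k : n ⊕ Fin 2) :
    ∑ l, A h l * nn A l i j k = (if h = k then mm A i j else 0) - (if h = i then mm A k j else 0)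
      - (if h = j then mm A i k else 0) := by
  have h1 := congrFun (congrFun (Matrix.adjugate_mul (bord A i j)) k) h
  rw [Matrix.mul_apply, Fintype.sum_sum_type] at h1
  simp only [Fin.sum_univ_two, Matrix.adjugate_apply, bord_updateRow_zero, bord_updateRow_one,
    bord_inl, bord_inr_zero, bord_inr_one, Matrix.smul_apply, Matrix.one_apply, Pi.single_apply,
    smul_eq_mul, mul_ite, mul_one, mul_zero] at h1
  have h2 : ∑ l, A h l * nn A l i j k =
      ∑ l, ((bord A i j).updateRow (Sum.inl l) (Pi.single k 1)).det * A h l :=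
    Finset.sum_congr rfl fun l _ => mul_comm _ _
  rw [h2, eq_sub_iff_add_eq, eq_sub_iff_add_eq, add_assoc, add_comm (ite (h = j) _ _)]
  simp only [eq_comm (a := h) (b := k)]
  exact h1

lemma sum_mul_nn2 (p l l' : n) (i j k : n ⊕ Fin 2) :
    ∑ h, A h l' * nn2 A p l i j k h =
      (if l' = l then nn A p i j k else 0) - (if l' = p then nn A l i j k else 0) := by
  by_cases hlp : l = p
  · subst hlp
    simp [nn2]
  simp only [nn2, if_neg hlp]
  refine (det_updateRow_eq _ (Sum.inl l) (fun h => A h l')).symm.trans ?_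
  by_cases h : l' = l
  · subst h
    rw [if_pos rfl, if_neg hlp, sub_zero]
    have : (fun h => A h l') =
        ((bord A i j).updateRow (Sum.inl p) (Pi.single k 1)) (Sum.inl l') := by
      simp [hlp, bord_inl]
    rw [this, Matrix.updateRow_eq_self]; rfl
  · rw [if_neg h, zero_sub]
    split_ifs with h'
    · subst h'
      refine det_swap_rows _ _ (Sum.inl l) (Sum.inl l') (by simpa using hlp) ?_ ?_ ?_
      · simp [bord_inl, h]
      · simp [h]
      · rintro (c | c) h1 h2
        · have h1 : c ≠ l := fun h => h1 (by rw [h])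
          have h2 : c ≠ l' := fun h => h2 (by rw [h])
          simp [h1, h2, bord_inl]
        · simp
    · rw [neg_zero]
      exact Matrix.det_zero_of_row_eq (i := Sum.inl l) (j := Sum.inl l') (by simpa using Ne.symm h)
        (by simp [h, h', bord_inl])

lemma sum_nn2_mul (p : n) (i j k h h' : n ⊕ Fin 2) (hi : h ≠ i) (hj : h ≠ j) (hk : h ≠ k) :
    ∑ l, A h l * nn2 A p l i j k h' = if h = h' then nn A p i j k else 0 := by
  have h1 := congrFun (congrFun (Matrix.adjugate_mul
    ((bord A i j).updateRow (Sum.inl p) (Pi.single k 1))) h') h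
  rw [Matrix.mul_apply, Fintype.sum_sum_type] at h1
  simp only [Fin.sum_univ_two, Matrix.adjugate_apply, Matrix.smul_apply, Matrix.one_apply,
    smul_eq_mul, mul_ite, mul_one, mul_zero] at h1
  rw [Matrix.updateRow_ne (by simp : (Sum.inr 0 : n ⊕ Fin 2) ≠ Sum.inl p),
    Matrix.updateRow_ne (by simp : (Sum.inr 1 : n ⊕ Fin 2) ≠ Sum.inl p), bord_inr_zero,
    bord_inr_one, Pi.single_eq_of_ne hi, Pi.single_eq_of_ne hj, mul_zero, mul_zero, add_zero,
    add_zero] at h1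
  simp only [eq_comm (a := h) (b := h')]
  refine Eq.trans (Finset.sum_congr rfl fun l _ => ?_) h1
  by_cases hlp : l = p
  · subst hlp
    simp [nn2, hk]
  · simp [nn2, hlp, bord_inl, mul_comm]

end Determinants

section Minors

lemma exists_perm_comp_eq {α γ : Type} [Finite γ] {f g : α → γ} (hf : Function.Injective f)
    (hg : Function.Injective g) : ∃ e : Equiv.Perm γ, ∀ x, e (f x) = g x := by
  classical
  let e₀ : {x // x ∈ Set.range f} ≃ {x // x ∈ Set.range g} :=
    (Equiv.ofInjective f hf).symm.trans (Equiv.ofInjective g hg)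
  refine ⟨e₀.extendSubtype, fun x => ?_⟩
  rw [Equiv.extendSubtype_apply_of_mem e₀ (f x) ⟨x, rfl⟩]
  have : (Equiv.ofInjective f hf).symm ⟨f x, ⟨x, rfl⟩⟩ = x :=
    (Equiv.ofInjective f hf).symm_apply_apply x
  simp only [e₀, Equiv.trans_apply, this]
  rfl

variable {R : Type} [CommRing R]

lemma isUnit_sign {γ : Type} [Fintype γ] [DecidableEq γ] (e : Equiv.Perm γ) :
    IsUnit (((Equiv.Perm.sign e : ℤ) : R)) :=
  (Units.isUnit (Equiv.Perm.sign e)).map (Int.castRingHom R)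

lemma associated_det_submatrix {γ : Type} [Fintype γ] [DecidableEq γ] (B : Matrix γ γ R)
    (e : Equiv.Perm γ) : Associated (B.submatrix id e).det B.det := by
  rw [Matrix.det_permute', mul_comm]
  exact (associated_mul_unit_left _ _ (isUnit_sign e))

variable {n : Type} [Fintype n] [DecidableEq n]

lemma associated_mm (A : Matrix (n ⊕ Fin 2) n R) (e : Equiv.Perm (n ⊕ Fin 2)) :
    Associated (mm A (e (Sum.inr 0)) (e (Sum.inr 1)))
      (A.submatrix (fun x => e (Sum.inl x)) id).det := by
  refine (associated_det_submatrix _ e).symm.trans ?_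
  have : (bord A (e (Sum.inr 0)) (e (Sum.inr 1))).submatrix id e =
      Matrix.fromBlocks (A.submatrix (fun x => e (Sum.inl x)) id)ᵀ
        (A.submatrix (fun x => e (Sum.inr x)) id)ᵀ 0 1 := by
    ext (a | a) (b | b)
    · rfl
    · rfl
    · fin_cases a <;> simp [bord_inr_zero, bord_inr_one]
    · fin_cases a <;> fin_cases b <;> simp [bord_inr_zero, bord_inr_one]
  rw [this, Matrix.det_fromBlocks_zero₂₁, Matrix.det_one, mul_one, Matrix.det_transpose]

lemma associated_nn {t : ℕ} (A : Matrix (Fin (t + 1) ⊕ Fin 2) (Fin (t + 1)) R)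
    (e : Equiv.Perm (Fin (t + 1) ⊕ Fin 2)) (l p : Fin (t + 1)) :
    Associated (nn A l (e (Sum.inr 0)) (e (Sum.inr 1)) (e (Sum.inl p)))
      (A.submatrix (fun x => e (Sum.inl (p.succAbove x))) l.succAbove).det := by
  refine (associated_det_submatrix _ e).symm.trans ?_
  have : ((bord A (e (Sum.inr 0)) (e (Sum.inr 1))).updateRow (Sum.inl l)
        (Pi.single (e (Sum.inl p)) 1)).submatrix id e =
      Matrix.fromBlocks ((A.submatrix (fun x => e (Sum.inl x)) id)ᵀ.updateRow l (Pi.single p 1))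
        ((A.submatrix (fun x => e (Sum.inr x)) id)ᵀ.updateRow l 0) 0 1 := by
    ext (a | a) (b | b)
    · by_cases h : a = l
      · subst h; simp [Pi.single_apply]
      · simp [h, bord_inl]
    · by_cases h : a = l
      · subst h; simp
      · simp [h, bord_inl]
    · fin_cases a <;> simp [bord_inr_zero, bord_inr_one]
    · fin_cases a <;> fin_cases b <;> simp [bord_inr_zero, bord_inr_one]
  rw [this, Matrix.det_fromBlocks_zero₂₁, Matrix.det_one, mul_one, ← Matrix.adjugate_apply,
    Matrix.adjugate_fin_succ_eq_det_submatrix, ← Matrix.det_transpose, mul_comm]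
  exact associated_mul_unit_left _ _ ((isUnit_one.neg).pow _)

lemma mm_mem_span (A : Matrix (n ⊕ Fin 2) n R) (i j : n ⊕ Fin 2) (I : Ideal R)
    (hI : ∀ r : n → n ⊕ Fin 2, Function.Injective r → (A.submatrix r id).det ∈ I) :
    mm A i j ∈ I := by
  by_cases hij : i = j
  · rw [hij, mm_self]; exact I.zero_mem
  obtain ⟨e, he⟩ := exists_perm_comp_eq (f := (Sum.inr : Fin 2 → n ⊕ Fin 2)) (g := ![i, j])
    Sum.inr_injective (by
      intro a b; fin_cases a <;> fin_cases b <;> simp [hij, Ne.symm hij])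
  have h := associated_mm A e
  rw [he 0, he 1] at h
  exact (h.symm.dvd.elim fun c hc => hc ▸ I.mul_mem_right c
    (hI _ (e.injective.comp Sum.inl_injective)))

lemma det_submatrix_mem_of_mm (A : Matrix (n ⊕ Fin 2) n R) (I : Ideal R)
    (hI : ∀ i j, mm A i j ∈ I) (r : n → n ⊕ Fin 2) (c : n → n) (hr : Function.Injective r)
    (hc : Function.Injective c) : (A.submatrix r c).det ∈ I := by
  let c' : n ≃ n := Equiv.ofBijective c (Finite.injective_iff_bijective.1 hc)
  obtain ⟨e, he⟩ := exists_perm_comp_eq (f := (Sum.inl : n → n ⊕ Fin 2)) (g := r ∘ c'.symm)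
    Sum.inl_injective (hr.comp c'.symm.injective)
  have h := associated_mm A e
  have h1 : A.submatrix r c = (A.submatrix (fun x => e (Sum.inl x)) id).submatrix c' c' := by
    ext a b
    simp [he, c']
  rw [h1, Matrix.det_submatrix_equiv_self]
  exact (h.dvd.elim fun c hc => hc ▸ I.mul_mem_right c (hI _ _))

lemma nn_mem_span {t : ℕ} (A : Matrix (Fin (t + 1) ⊕ Fin 2) (Fin (t + 1)) R) (l : Fin (t + 1))
    (i j k : Fin (t + 1) ⊕ Fin 2) (I : Ideal R)
    (hI : ∀ (r : Fin t → Fin (t + 1) ⊕ Fin 2) (c : Fin t → Fin (t + 1)), Function.Injective r →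
      Function.Injective c → (A.submatrix r c).det ∈ I) :
    nn A l i j k ∈ I := by
  by_cases hij : i = j
  · rw [hij, nn_self₁₂]; exact I.zero_mem
  by_cases hik : k = i
  · rw [hik, nn_self₁₃]; exact I.zero_mem
  by_cases hjk : k = j
  · rw [hjk, nn_self₂₃]; exact I.zero_mem
  obtain ⟨e, he⟩ := exists_perm_comp_eq
    (f := (![Sum.inr 0, Sum.inr 1, Sum.inl 0] : Fin 3 → Fin (t + 1) ⊕ Fin 2)) (g := ![i, j, k])
    (by intro a b; fin_cases a <;> fin_cases b <;> simp)
    (by intro a b; fin_cases a <;> fin_cases b <;>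
          simp [hij, Ne.symm hij, hik, hjk, Ne.symm hik, Ne.symm hjk])
  have h := associated_nn A e l 0
  have h0 : e (Sum.inr 0) = i := he 0
  have h1 : e (Sum.inr 1) = j := he 1
  have h2 : e (Sum.inl 0) = k := he 2
  rw [h0, h1, h2] at h
  exact (h.symm.dvd.elim fun c hc => hc ▸ I.mul_mem_right c
    (hI _ _ (e.injective.comp (Sum.inl_injective.comp Fin.succAbove_right_injective))
      Fin.succAbove_right_injective))

lemma det_submatrix_mem_of_nn {t : ℕ} (A : Matrix (Fin (t + 1) ⊕ Fin 2) (Fin (t + 1)) R)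
    (I : Ideal R) (hI : ∀ l i j k, nn A l i j k ∈ I) (r : Fin t → Fin (t + 1) ⊕ Fin 2)
    (c : Fin t → Fin (t + 1)) (hr : Function.Injective r) (hc : Function.Injective c) :
    (A.submatrix r c).det ∈ I := by
  obtain ⟨l, hl⟩ : ∃ l, ∀ x, c x ≠ l := by
    by_contra! h
    have := Fintype.card_le_of_surjective c h
    simp at this
  choose s hs using fun x => Fin.exists_succAbove_eq (hl x)
  have hsi : Function.Injective s := fun x y hxy => hc (by rw [← hs x, ← hs y, hxy])
  let s' : Fin t ≃ Fin t := Equiv.ofBijective s (Finite.injective_iff_bijective.1 hsi)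
  obtain ⟨e, he⟩ := exists_perm_comp_eq
    (f := fun x : Fin t => (Sum.inl ((0 : Fin (t + 1)).succAbove x) : Fin (t + 1) ⊕ Fin 2))
    (g := r ∘ s'.symm) (Sum.inl_injective.comp Fin.succAbove_right_injective)
    (hr.comp s'.symm.injective)
  have h := associated_nn A e l 0
  have h1 : A.submatrix r c = (A.submatrix (fun x => e (Sum.inl ((0 : Fin (t + 1)).succAbove x)))
      l.succAbove).submatrix s' s' := by
    ext a b
    simp only [Matrix.submatrix_apply]
    rw [he]
    simp [s', hs]
  rw [h1, Matrix.det_submatrix_equiv_self]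
  exact (h.dvd.elim fun c hc => hc ▸ I.mul_mem_right c (hI _ _ _ _))

end Minors

section ModuleMatrix

set_option linter.unusedSectionVars false

variable {R : Type} [CommRing R] {N N' : Type} [AddCommGroup N] [Module R N]
  [AddCommGroup N'] [Module R N'] {a b c d : Type}

/-- The product of a matrix over `R` and a matrix with entries in an `R`-module. -/
def lmul [Fintype b] (B : Matrix a b R) : Matrix b c N →ₗ[R] Matrix a c N where
  toFun X := Matrix.of fun i j => ∑ k, B i k • X k j
  map_add' X Y := by ext; simp [Finset.sum_add_distrib]
  map_smul' r X := by ext; simp [Finset.smul_sum, smul_comm r]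

lemma lmul_apply [Fintype b] (B : Matrix a b R) (X : Matrix b c N) (i : a) (j : c) :
    lmul B X i j = ∑ k, B i k • X k j := rfl

lemma lmul_mul [Fintype b] [Fintype c] (B : Matrix a b R) (C : Matrix b c R) (X : Matrix c d N) :
    lmul (B * C) X = lmul B (lmul C X) := by
  ext i j
  simp only [lmul_apply, Matrix.mul_apply, Finset.sum_smul, Finset.smul_sum, mul_smul]
  exact Finset.sum_comm

lemma lmul_smul_one [Fintype b] [DecidableEq b] (r : R) (X : Matrix b c N) :
    lmul (r • (1 : Matrix b b R)) X = r • X := by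
  ext i j
  simp [lmul_apply, Matrix.one_apply, ite_smul]

/-- Left and right multiplication by scalar matrices commute. -/
lemma lmul_transpose_comm [Fintype b] [Fintype d] (B : Matrix a b R) (C : Matrix c d R)
    (X : Matrix b d N) : lmul B (lmul C Xᵀ)ᵀ = (lmul C (lmul B X)ᵀ)ᵀ := by
  ext i j
  simp only [lmul_apply, Matrix.transpose_apply, Finset.smul_sum]
  rw [Finset.sum_comm]
  exact Finset.sum_congr rfl fun _ _ => Finset.sum_congr rfl fun _ _ => smul_comm _ _ _

variable (R N a) in
/-- The symmetric matrices with entries in `N`. -/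
def SymM : Submodule R (Matrix a a N) where
  carrier := {X | Xᵀ = X}
  add_mem' hX hY := by
    simp only [Set.mem_ofPred_eq] at *
    rw [Matrix.transpose_add, hX, hY]
  zero_mem' := Matrix.transpose_zero
  smul_mem' r X hX := by
    simp only [Set.mem_ofPred_eq] at *
    rw [Matrix.transpose_smul, hX]

variable (R N a) in
/-- The alternating matrices with entries in `N`, when `2` is invertible. -/
def AltM : Submodule R (Matrix a a N) where
  carrier := {X | Xᵀ = -X}
  add_mem' hX hY := by
    simp only [Set.mem_ofPred_eq] at *
    rw [Matrix.transpose_add, hX, hY, neg_add]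
  zero_mem' := by simp
  smul_mem' r X hX := by
    simp only [Set.mem_ofPred_eq] at *
    rw [Matrix.transpose_smul, hX, smul_neg]

lemma mem_SymM {X : Matrix a a N} : X ∈ SymM R N a ↔ Xᵀ = X := Iff.rfl
lemma mem_AltM {X : Matrix a a N} : X ∈ AltM R N a ↔ Xᵀ = -X := Iff.rfl

lemma SymM.apply_comm (X : SymM R N a) (i j : a) : X.1 i j = X.1 j i :=
  congrFun (congrFun X.2 j) i

lemma AltM.apply_comm (X : AltM R N a) (i j : a) : X.1 i j = - X.1 j i :=
  congrFun (congrFun X.2 j) i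

variable (R N a) in
/-- Symmetrization. -/
def toSym : Matrix a a N →ₗ[R] SymM R N a :=
  LinearMap.codRestrict _ (LinearMap.id + (Matrix.transposeLinearEquiv a a R N).toLinearMap)
    fun X => by
      change (X + Xᵀ)ᵀ = X + Xᵀ
      rw [Matrix.transpose_add, Matrix.transpose_transpose, add_comm]

variable (R N a) in
/-- Antisymmetrization. -/
def toAlt : Matrix a a N →ₗ[R] AltM R N a :=
  LinearMap.codRestrict _ (LinearMap.id - (Matrix.transposeLinearEquiv a a R N).toLinearMap)
    fun X => by
      change (X - Xᵀ)ᵀ = -(X - Xᵀ)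
      rw [Matrix.transpose_sub, Matrix.transpose_transpose, neg_sub]

lemma toSym_coe (X : Matrix a a N) : (toSym R N a X : Matrix a a N) = X + Xᵀ := rfl
lemma toAlt_coe (X : Matrix a a N) : (toAlt R N a X : Matrix a a N) = X - Xᵀ := rfl

/-- The map `Y ↦ Y Aᵀ - A Yᵀ`. -/
def altMul [Fintype a] (A : Matrix b a R) : Matrix b a N →ₗ[R] AltM R N b :=
  - (toAlt R N b ∘ₗ lmul A ∘ₗ (Matrix.transposeLinearEquiv b a R N).toLinearMap)

lemma altMul_coe [Fintype a] (A : Matrix b a R) (Y : Matrix b a N) :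
    (altMul A Y : Matrix b b N) = (lmul A Yᵀ)ᵀ - lmul A Yᵀ :=
  neg_sub _ _

/-- The map `Q ↦ A Q` on symmetric matrices. -/
def symMul [Fintype a] (A : Matrix b a R) : SymM R N a →ₗ[R] Matrix b a N :=
  lmul A ∘ₗ (SymM R N a).subtype

lemma altMul_symMul [Fintype a] (A : Matrix b a R) (Q : SymM R N a) :
    altMul A (symMul A Q) = 0 := by
  apply Subtype.ext
  rw [altMul_coe]
  change (lmul A (lmul A Q.1)ᵀ)ᵀ - lmul A (lmul A Q.1)ᵀ = 0
  rw [← lmul_transpose_comm, mem_SymM.1 Q.2, sub_self]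

variable [Invertible (2 : R)]

lemma eq_half (x : N) : (⅟2 : R) • (x + x) = x := by
  rw [← two_smul R x, smul_smul, invOf_mul_self, one_smul]

lemma toSym_half : toSym R N a ∘ₗ ((⅟2 : R) • (SymM R N a).subtype) = LinearMap.id := by
  ext X i j
  change ((⅟2 : R) • X.1) i j + ((⅟2 : R) • X.1) j i = X.1 i j
  rw [Matrix.smul_apply, Matrix.smul_apply, SymM.apply_comm X j i, ← smul_add, eq_half]

lemma toAlt_half : toAlt R N a ∘ₗ ((⅟2 : R) • (AltM R N a).subtype) = LinearMap.id := by
  ext X i j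
  change ((⅟2 : R) • X.1) i j - ((⅟2 : R) • X.1) j i = X.1 i j
  rw [Matrix.smul_apply, Matrix.smul_apply, AltM.apply_comm X j i, ← smul_sub, sub_neg_eq_add,
    eq_half]

lemma eq_zero_of_add_self {x : N} (h : x + x = 0) (R : Type) [CommRing R] [Module R N]
    [Invertible (2 : R)] : x = 0 := by
  rw [← eq_half (R := R) x, h, smul_zero]

lemma Dep.sym [Fintype a] {J : Ideal R} {d : ℕ} (h : Dep J d N) : Dep J d (SymM R N a) :=
  (Dep.matrix h).retract _ _ toSym_half

lemma Dep.alt [Fintype a] {J : Ideal R} {d : ℕ} (h : Dep J d N) : Dep J d (AltM R N a) :=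
  (Dep.matrix h).retract _ _ toAlt_half

instance [Finite a] : Module.Projective R (SymM R R a) :=
  .of_split _ _ (toSym_half (R := R) (N := R))

instance [Finite a] : Module.Projective R (AltM R R a) :=
  .of_split _ _ (toAlt_half (R := R) (N := R))

variable [Fintype a] [Fintype b] [DecidableEq b]

/-- Away from `T`, a power of the scalar `μ` times an alternating matrix lies in the image of
`altMul A`, when the rows of `A D` and of `μ` outside of `T` agree. -/
lemma exists_altMul_eq_outside (A : Matrix b a R) (D : Matrix a b R) (μ : R) (T : Set b)
    (hD : ∀ h ∉ T, ∀ h', (A * D) h h' = if h = h' then μ else 0) (W : AltM R N b) :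
    ∃ Y : Matrix b a N, ∀ h h', (h ∉ T ∨ h' ∉ T) → (μ ^ 2 • W - altMul A Y).1 h h' = 0 := by
  obtain ⟨W, hW⟩ := W
  rw [mem_AltM] at hW
  set P := A * D
  set X := μ • W - lmul P W with hX
  set V := μ • X - (lmul P Xᵀ)ᵀ with hV
  have hXrow : ∀ h ∉ T, ∀ h', X h h' = 0 := by
    intro h hh h'
    simp [hX, lmul_apply, hD h hh, ite_smul]
  have hVs : ∀ h h', (h ∉ T ∨ h' ∉ T) → V h h' = 0 := by
    rintro h h' (hh | hh)
    · simp [hV, lmul_apply, hXrow h hh]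
    · simp [hV, lmul_apply, hD h' hh, ite_smul]
  set E := lmul D W
  set F := (lmul D Eᵀ)ᵀ with hF
  have hE : (lmul D Wᵀ)ᵀ = -Eᵀ := by rw [hW, map_neg, Matrix.transpose_neg]
  have hFt : Fᵀ = -F := by
    have := lmul_transpose_comm D D Wᵀ
    rw [Matrix.transpose_transpose] at this
    refine (Matrix.transpose_transpose _).trans (this.trans ?_)
    rw [hW, map_neg, Matrix.transpose_neg, map_neg, Matrix.transpose_neg]
  have hPW : lmul P W = lmul A E := lmul_mul _ _ _
  have hPWt : (lmul P Wᵀ)ᵀ = -(lmul A E)ᵀ := by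
    rw [hW, map_neg, Matrix.transpose_neg, hPW]
  have hPPW : (lmul P (lmul P W)ᵀ)ᵀ = (lmul A (lmul A F)ᵀ)ᵀ := by
    rw [hPW, lmul_mul, ← Matrix.transpose_transpose E, lmul_transpose_comm D A Eᵀ]
  have hG : lmul A (lmul A F)ᵀ = -(lmul A (lmul A F)ᵀ)ᵀ := by
    have := lmul_transpose_comm A A Fᵀ
    rw [Matrix.transpose_transpose, hFt, map_neg, Matrix.transpose_neg, map_neg,
      Matrix.transpose_neg] at this
    exact this
  have hVe : V = μ ^ 2 • W - μ • lmul A E + μ • (lmul A E)ᵀ + (lmul A (lmul A F)ᵀ)ᵀ := by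
    rw [hV, hX, Matrix.transpose_sub, map_sub, Matrix.transpose_sub, hPPW, Matrix.transpose_smul,
      map_smul, Matrix.transpose_smul, hPWt, hPW, smul_sub, smul_smul, ← pow_two, smul_neg]
    abel
  refine ⟨-(μ • Eᵀ) - (⅟2 : R) • lmul A F, fun h h' hh => ?_⟩
  rw [← hVs h h' hh]
  have h1 : (altMul A (lmul A F)).1 = (lmul A (lmul A F)ᵀ)ᵀ + (lmul A (lmul A F)ᵀ)ᵀ := by
    exact (altMul_coe A _).trans ((congrArg _ hG).trans (sub_neg_eq_add _ _))
  suffices h2 : μ ^ 2 • W - (altMul A (-(μ • Eᵀ) - (⅟2 : R) • lmul A F)).1 = V from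
    congrFun (congrFun h2 h) h'
  rw [map_sub, map_neg, map_smul, map_smul, Submodule.coe_sub, Submodule.coe_neg,
    Submodule.coe_smul, Submodule.coe_smul, h1, eq_half, altMul_coe, hVe,
    Matrix.transpose_transpose, smul_sub]
  abel

end ModuleMatrix

section FreeComplexes

set_option linter.unusedSectionVars false

variable {R : Type} [CommRing R] {n : Type} [Fintype n] [DecidableEq n]
  (A : Matrix (n ⊕ Fin 2) n R)

/-- The alternating matrix of maximal minors. -/
def PM : Matrix (n ⊕ Fin 2) (n ⊕ Fin 2) R := Matrix.of (mm A)

/-- The matrix of submaximal minors complementary to two given rows. -/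
def DM (i j : n ⊕ Fin 2) : Matrix n (n ⊕ Fin 2) R := Matrix.of fun l h => nn A l i j h

/-- The ideal of maximal minors. -/
def mI : Ideal R := Ideal.span (Set.range fun p : (n ⊕ Fin 2) × (n ⊕ Fin 2) => mm A p.1 p.2)

/-- A maximal minor as an element of the ideal of maximal minors. -/
def qq (i j : n ⊕ Fin 2) : mI A := ⟨mm A i j, Ideal.subset_span ⟨(i, j), rfl⟩⟩

lemma PM_transpose : (PM A)ᵀ = -PM A := by
  ext i j
  exact mm_swap A i j

lemma transpose_mul_PM : Aᵀ * PM A = 0 := by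
  ext l j
  exact sum_mul_mm A l j

lemma PM_mul : PM A * A = 0 := by
  have := congrArg Matrix.transpose (transpose_mul_PM A)
  rw [Matrix.transpose_mul, Matrix.transpose_transpose, PM_transpose, Matrix.neg_mul] at this
  exact neg_eq_zero.1 this

lemma DM_mul (i j : n ⊕ Fin 2) : DM A i j * A = mm A i j • 1 := by
  ext l l'
  rw [Matrix.mul_apply, Matrix.smul_apply, Matrix.one_apply, smul_eq_mul, mul_ite, mul_one,
    mul_zero]
  simp only [eq_comm (a := l)]
  exact (Finset.sum_congr rfl fun _ _ => mul_comm _ _).trans (sum_mul_nn A l l' i j)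

lemma mul_DM (i j h h' : n ⊕ Fin 2) (hi : h ≠ i) (hj : h ≠ j) :
    (A * DM A i j) h h' = if h = h' then mm A i j else 0 := by
  refine (sum_nn_mul A i j h h').trans ?_
  rw [if_neg hi, if_neg hj, sub_zero, sub_zero]

lemma qq_swap (i j : n ⊕ Fin 2) : qq A j i = -qq A i j := Subtype.ext (mm_swap A i j)

lemma sum_smul_qq (l : n) (j : n ⊕ Fin 2) : ∑ h, A h l • qq A h j = 0 := by
  apply Subtype.ext
  rw [AddSubmonoidClass.coe_finsetSum]
  exact sum_mul_mm A l j

variable {N : Type} [AddCommGroup N] [Module R N]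

/-- The pairing of a matrix with entries in `N` with the maximal minors. -/
def pairSum : Matrix (n ⊕ Fin 2) (n ⊕ Fin 2) N →ₗ[R] N ⊗[R] mI A where
  toFun W := ∑ a, ∑ b, W a b ⊗ₜ[R] qq A a b
  map_add' X Y := by simp [TensorProduct.add_tmul, Finset.sum_add_distrib]
  map_smul' r X := by simp [Finset.smul_sum, TensorProduct.smul_tmul']

lemma pairSum_apply (W : Matrix (n ⊕ Fin 2) (n ⊕ Fin 2) N) :
    pairSum A W = ∑ a, ∑ b, W a b ⊗ₜ[R] qq A a b := rfl

lemma pairSum_single (i j : n ⊕ Fin 2) (x : N) :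
    pairSum A (Matrix.single i j x) = x ⊗ₜ qq A i j := by
  rw [pairSum_apply, Finset.sum_eq_single i, Finset.sum_eq_single j]
  · simp
  · intro b _ hb; rw [Matrix.single_apply_of_ne _ _ _ _ _ (by simp [hb.symm]),
      TensorProduct.zero_tmul]
  · simp
  · intro a _ ha
    refine Finset.sum_eq_zero fun b _ => ?_
    rw [Matrix.single_apply_of_ne _ _ _ _ _ (by simp [ha.symm]), TensorProduct.zero_tmul]
  · simp

lemma pairSum_transpose (W : Matrix (n ⊕ Fin 2) (n ⊕ Fin 2) N) :
    pairSum A Wᵀ = - pairSum A W := by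
  rw [pairSum_apply, pairSum_apply, Finset.sum_comm, ← Finset.sum_neg_distrib]
  refine Finset.sum_congr rfl fun a _ => ?_
  rw [← Finset.sum_neg_distrib]
  refine Finset.sum_congr rfl fun b _ => ?_
  rw [Matrix.transpose_apply, qq_swap, TensorProduct.tmul_neg]

lemma pairSum_lmul (Y : Matrix n (n ⊕ Fin 2) N) : pairSum A (lmul A Y) = 0 := by
  rw [pairSum_apply, Finset.sum_comm]
  refine Finset.sum_eq_zero fun b _ => ?_
  simp only [lmul_apply, TensorProduct.sum_tmul]
  rw [Finset.sum_comm]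
  refine Finset.sum_eq_zero fun l _ => ?_
  simp only [TensorProduct.smul_tmul]
  rw [← TensorProduct.tmul_sum, sum_smul_qq, TensorProduct.tmul_zero]

lemma pairSum_altMul (Y : Matrix (n ⊕ Fin 2) n N) : pairSum A (altMul A Y).1 = 0 := by
  rw [altMul_coe, map_sub, pairSum_transpose, pairSum_lmul, neg_zero, sub_zero]

variable [Invertible (2 : R)]

lemma span_qq : Submodule.span R (Set.range fun p : (n ⊕ Fin 2) × (n ⊕ Fin 2) =>
    qq A p.1 p.2) = ⊤ := by
  have h : (Set.range fun p : (n ⊕ Fin 2) × (n ⊕ Fin 2) => qq A p.1 p.2) =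
      Subtype.val ⁻¹' (Set.range fun p : (n ⊕ Fin 2) × (n ⊕ Fin 2) => mm A p.1 p.2) := by
    ext x
    simp [Subtype.ext_iff, qq]
  rw [h]
  exact Submodule.span_span_coe_preimage

lemma pairSum_alt_surjective (z : N ⊗[R] mI A) : ∃ W : AltM R N (n ⊕ Fin 2), pairSum A W.1 = z := by
  have h1 : ∀ z : N ⊗[R] mI A, z ∈ LinearMap.range (pairSum A (N := N)) := by
    intro z
    induction z using TensorProduct.induction_on with
    | zero => exact Submodule.zero_mem _
    | add x y hx hy => exact Submodule.add_mem _ hx hy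
    | tmul x y =>
      have hy : y ∈ Submodule.span R (Set.range fun p : (n ⊕ Fin 2) × (n ⊕ Fin 2) =>
        qq A p.1 p.2) := by rw [span_qq]; trivial
      induction hy using Submodule.span_induction with
      | mem y hy =>
        obtain ⟨p, rfl⟩ := hy
        exact ⟨_, pairSum_single A p.1 p.2 x⟩
      | zero => rw [TensorProduct.tmul_zero]; exact Submodule.zero_mem _
      | add y y' _ _ h h' => rw [TensorProduct.tmul_add]; exact Submodule.add_mem _ h h'
      | smul r y _ h => rw [TensorProduct.tmul_smul]; exact Submodule.smul_mem _ _ h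
  obtain ⟨W, rfl⟩ := h1 z
  refine ⟨(⅟2 : R) • toAlt R N _ W, ?_⟩
  rw [Submodule.coe_smul, map_smul, toAlt_coe, map_sub, pairSum_transpose, sub_neg_eq_add, eq_half]

/-- The map from alternating matrices onto the ideal of maximal minors. -/
def altSum : AltM R R (n ⊕ Fin 2) →ₗ[R] mI A :=
  (TensorProduct.lid R (mI A)).toLinearMap ∘ₗ pairSum A ∘ₗ (AltM R R (n ⊕ Fin 2)).subtype

lemma altSum_surjective : Function.Surjective (altSum A) := fun z => by
  obtain ⟨W, hW⟩ := pairSum_alt_surjective A ((TensorProduct.lid R (mI A)).symm z)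
  exact ⟨W, by simp [altSum, hW]⟩

lemma altSum_altMul (Y : Matrix (n ⊕ Fin 2) n R) : altSum A (altMul A Y) = 0 := by
  simp [altSum, pairSum_altMul]

lemma AltM.apply_self (V : AltM R N (n ⊕ Fin 2)) (i : n ⊕ Fin 2) : V.1 i i = 0 :=
  eq_zero_of_add_self (by nth_rw 1 [AltM.apply_comm V i i]; exact neg_add_cancel _) R

lemma AltM.eq_of_support_pair (V : AltM R N (n ⊕ Fin 2)) (i j : n ⊕ Fin 2) (hij : i ≠ j)
    (hV : ∀ h h', (h ∉ ({i, j} : Set (n ⊕ Fin 2)) ∨ h' ∉ ({i, j} : Set (n ⊕ Fin 2))) →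
      V.1 h h' = 0) : V = toAlt R N _ (Matrix.single i j (V.1 i j)) := by
  apply Subtype.ext
  rw [toAlt_coe, Matrix.transpose_single]
  ext a b
  rw [Matrix.sub_apply]
  by_cases ha : a ∈ ({i, j} : Set (n ⊕ Fin 2))
  swap
  · rw [hV a b (Or.inl ha)]
    simp only [Set.mem_insert_iff, Set.mem_singleton_iff, not_or] at ha
    simp [Ne.symm ha.1, Ne.symm ha.2]
  by_cases hb : b ∈ ({i, j} : Set (n ⊕ Fin 2))
  swap
  · rw [hV a b (Or.inr hb)]
    simp only [Set.mem_insert_iff, Set.mem_singleton_iff, not_or] at hb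
    simp [Ne.symm hb.1, Ne.symm hb.2]
  rcases ha with rfl | rfl <;> rcases hb with rfl | rfl
  · simp [hij.symm, AltM.apply_self V]
  · simp [hij]
  · simp [hij, hij.symm, AltM.apply_comm V a b]
  · simp [hij, AltM.apply_self V]

lemma smul_eq_lmul_DM {c : Type} (i j : n ⊕ Fin 2) (X : Matrix n c N) :
    lmul (DM A i j) (lmul A X) = mm A i j • X := by
  rw [← lmul_mul, DM_mul, lmul_smul_one]

variable [IsNoetherianRing R]

lemma symMul_injective_and_dep (h3 : Dep (mI A) 3 R) :
    Function.Injective (symMul A (N := R)) ∧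
      Dep (mI A) 2 (Matrix (n ⊕ Fin 2) n R ⧸ LinearMap.range (symMul A (N := R))) := by
  refine Dep.acyclic_start rfl (Dep.mono h3 (by lia)).matrix h3.sym ?_
  rintro Q hQ _ ⟨⟨i, j⟩, rfl⟩
  refine ⟨1, Subtype.ext ?_⟩
  rw [pow_one]
  change mm A i j • Q.1 = 0
  rw [← smul_eq_lmul_DM]
  exact (congrArg _ hQ).trans (map_zero _)

lemma altMul_exact_and_dep (h3 : Dep (mI A) 3 R) :
    Function.Exact (symMul A (N := R)) (altMul A (N := R)) ∧
      Dep (mI A) 1 (AltM R R (n ⊕ Fin 2) ⧸ LinearMap.range (altMul A (N := R))) := by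
  refine Dep.acyclic_step rfl (altMul_symMul A) (Dep.mono h3 (by lia)).alt
    (symMul_injective_and_dep A h3).2 ?_
  rintro Y hY _ ⟨⟨i, j⟩, rfl⟩
  have h0 : (lmul A Yᵀ)ᵀ = lmul A Yᵀ := by
    rw [← sub_eq_zero, ← altMul_coe, hY]; rfl
  set Z := lmul (DM A i j) Y with hZ
  have h1 : mm A i j • Y = lmul A Zᵀ := by
    rw [← Matrix.transpose_transpose Y, ← Matrix.transpose_smul, ← smul_eq_lmul_DM, ← h0,
      lmul_transpose_comm, Matrix.transpose_transpose]
  have h2 : mm A i j • Z = mm A i j • Zᵀ := by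
    rw [← smul_eq_lmul_DM A i j Zᵀ, ← h1, map_smul]
  refine ⟨2, ⟨mm A i j • Zᵀ, ?_⟩, ?_⟩
  · rw [mem_SymM, Matrix.transpose_smul, Matrix.transpose_transpose, h2]
  · change lmul A (mm A i j • Zᵀ) = _
    rw [map_smul, ← h1, smul_smul, pow_two]

lemma altSum_exact (h3 : Dep (mI A) 3 R) : Function.Exact (altMul A (N := R)) (altSum A) := by
  refine Dep.exact_of_torsion rfl (altSum_altMul A) (altMul_exact_and_dep A h3).2 ?_
  rintro W hW _ ⟨⟨i, j⟩, rfl⟩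
  by_cases hij : i = j
  · refine ⟨1, 0, ?_⟩
    change altMul A 0 = mm A i j ^ 1 • W
    rw [hij, mm_self, pow_one, zero_smul, map_zero]
  obtain ⟨Y, hY⟩ := exists_altMul_eq_outside A (DM A i j) (mm A i j) {i, j} (fun h hh h' => by
    simp only [Set.mem_insert_iff, Set.mem_singleton_iff, not_or] at hh
    exact mul_DM A i j h h' hh.1 hh.2) W
  set V := mm A i j ^ 2 • W - altMul A Y with hV
  have h1 := AltM.eq_of_support_pair V i j hij hY
  have h2 : altSum A V = 0 := by
    rw [hV, map_sub, map_smul, hW, altSum_altMul, smul_zero, sub_zero]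
  have h3 : V.1 i j * mm A i j = 0 := by
    rw [h1] at h2
    have h4 : altSum A (toAlt R R _ (Matrix.single i j (V.1 i j))) =
        V.1 i j • qq A i j + V.1 i j • qq A i j := by
      simp [altSum, toAlt_coe, pairSum_single, qq_swap A i j]
    exact congrArg Subtype.val (eq_zero_of_add_self (h4.symm.trans h2) R)
  have h4 : mm A i j • V = 0 := by
    rw [h1, ← map_smul, Matrix.smul_single, smul_eq_mul, mul_comm, h3, Matrix.single_zero, map_zero]
  refine ⟨3, mm A i j • Y, ?_⟩
  rw [hV, smul_sub, sub_eq_zero] at h4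
  rw [map_smul, ← h4, smul_smul, ← pow_succ']

end FreeComplexes

section BuchsbaumRim

set_option linter.unusedSectionVars false

variable {R : Type} [CommRing R] {n : Type} [Fintype n] [DecidableEq n]
  (A : Matrix (n ⊕ Fin 2) n R)

lemma transpose_mulVec_PM (z : n ⊕ Fin 2 → R) :
    Aᵀ.mulVecLin ((PM A).mulVecLin z) = 0 := by
  rw [Matrix.mulVecLin_apply, Matrix.mulVecLin_apply, Matrix.mulVec_mulVec, transpose_mul_PM,
    Matrix.zero_mulVec]

lemma PM_mulVec_mulVec (z : n → R) : (PM A).mulVecLin (A.mulVecLin z) = 0 := by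
  rw [Matrix.mulVecLin_apply, Matrix.mulVecLin_apply, Matrix.mulVec_mulVec, PM_mul,
    Matrix.zero_mulVec]

variable [IsNoetherianRing R]

lemma mulVec_injective_and_dep (h3 : Dep (mI A) 3 R) :
    Function.Injective A.mulVecLin ∧
      Dep (mI A) 2 ((n ⊕ Fin 2 → R) ⧸ LinearMap.range A.mulVecLin) := by
  refine Dep.acyclic_start rfl (Dep.mono h3 (by lia)).pi h3.pi ?_
  rintro v hv _ ⟨⟨i, j⟩, rfl⟩
  refine ⟨1, ?_⟩
  have : (DM A i j) *ᵥ (A *ᵥ v) = mm A i j • v := by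
    rw [Matrix.mulVec_mulVec, DM_mul, Matrix.smul_mulVec, Matrix.one_mulVec]
  rw [Matrix.mulVecLin_apply] at hv
  rw [pow_one, ← this, hv, Matrix.mulVec_zero]

lemma PM_exact_and_dep (h3 : Dep (mI A) 3 R) :
    Function.Exact A.mulVecLin (PM A).mulVecLin ∧
      Dep (mI A) 1 ((n ⊕ Fin 2 → R) ⧸ LinearMap.range (PM A).mulVecLin) := by
  refine Dep.acyclic_step rfl (PM_mulVec_mulVec A) (Dep.mono h3 (by lia)).pi
    (mulVec_injective_and_dep A h3).2 ?_
  rintro g hg _ ⟨⟨i, j⟩, rfl⟩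
  by_cases hij : i = j
  · refine ⟨1, 0, ?_⟩
    change _ = mm A i j ^ 1 • g
    rw [hij, mm_self, pow_one, zero_smul, map_zero]
  set w := mm A i j • g - A *ᵥ (DM A i j *ᵥ g) with hw
  have hw0 : ∀ h, h ≠ i → h ≠ j → w h = 0 := by
    intro h hi hj
    rw [hw, Matrix.mulVec_mulVec, Pi.sub_apply, Pi.smul_apply, smul_eq_mul]
    simp [Matrix.mulVec, dotProduct, mul_DM A i j h _ hi hj]
  have hPw : PM A *ᵥ w = 0 := by
    rw [Matrix.mulVecLin_apply] at hg
    rw [hw, Matrix.mulVec_sub, Matrix.mulVec_smul, hg, smul_zero, Matrix.mulVec_mulVec, PM_mul,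
      Matrix.zero_mulVec, sub_zero]
  have hs : ∀ h, mm A h i * w i + mm A h j * w j = 0 := by
    intro h
    refine Eq.trans ?_ (congrFun hPw h)
    symm
    refine (Fintype.sum_eq_add (f := fun x => mm A h x * w x) i j hij fun x hx => ?_)
    rw [hw0 x hx.1 hx.2, mul_zero]
  have hi := hs i
  have hj := hs j
  rw [mm_self, zero_mul, zero_add] at hi
  rw [mm_self, zero_mul, add_zero, mm_swap A i j, neg_mul, neg_eq_zero] at hj
  have h0 : mm A i j • w = 0 := by
    ext h
    rw [Pi.smul_apply, smul_eq_mul]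
    by_cases h1 : h = i
    · rw [h1, hj]; rfl
    · by_cases h2 : h = j
      · rw [h2, hi]; rfl
      · rw [hw0 h h1 h2, mul_zero]; rfl
  refine ⟨2, mm A i j • DM A i j *ᵥ g, ?_⟩
  rw [hw, smul_sub, sub_eq_zero, smul_smul, ← pow_two] at h0
  rw [Matrix.mulVecLin_apply, Matrix.mulVec_smul, ← h0]

lemma transpose_exact (h3 : Dep (mI A) 3 R) :
    Function.Exact (PM A).mulVecLin Aᵀ.mulVecLin := by
  refine Dep.exact_of_torsion rfl (transpose_mulVec_PM A) (PM_exact_and_dep A h3).2 ?_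
  rintro z hz _ ⟨⟨i, j⟩, rfl⟩
  by_cases hij : i = j
  · refine ⟨1, 0, ?_⟩
    change _ = mm A i j ^ 1 • z
    rw [hij, mm_self, pow_one, zero_smul, map_zero]
  set g : n ⊕ Fin 2 → R := Pi.single j (z i) - Pi.single i (z j) with hg
  set w := mm A i j • z - PM A *ᵥ g with hw
  have hwh : ∀ h, w h = mm A i j * z h - (mm A h j * z i - mm A h i * z j) := by
    intro h
    rw [hw, hg, Matrix.mulVec_sub, Matrix.mulVec_single, Matrix.mulVec_single]
    simp [PM, mul_comm]
  have hwi : w i = 0 := by rw [hwh, mm_self]; ring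
  have hwj : w j = 0 := by rw [hwh, mm_self, mm_swap A i j]; ring
  have hAw : w ᵥ* A = 0 := by
    rw [Matrix.mulVecLin_apply, Matrix.mulVec_transpose] at hz
    rw [hw, Matrix.sub_vecMul, Matrix.smul_vecMul, hz, smul_zero, zero_sub, neg_eq_zero,
      ← Matrix.mulVec_transpose]
    exact transpose_mulVec_PM A g
  have h0 : mm A i j • w = 0 := by
    ext h
    have h1 : w ᵥ* (A * DM A i j) = 0 := by
      rw [← Matrix.vecMul_vecMul, hAw, Matrix.zero_vecMul]
    rw [← congrFun h1 h, Matrix.vecMul, dotProduct, Finset.sum_eq_single h]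
    · by_cases hi : h = i
      · rw [hi, Pi.smul_apply, hwi]; simp
      by_cases hj : h = j
      · rw [hj, Pi.smul_apply, hwj]; simp
      rw [mul_DM A i j h h hi hj, if_pos rfl, mul_comm]; rfl
    · intro x _ hx
      by_cases hi : x = i
      · rw [hi, hwi, zero_mul]
      by_cases hj : x = j
      · rw [hj, hwj, zero_mul]
      rw [mul_DM A i j x h hi hj, if_neg hx, mul_zero]
    · simp
  refine ⟨2, mm A i j • g, ?_⟩
  rw [hw, smul_sub, sub_eq_zero, smul_smul, ← pow_two] at h0
  rw [h0, map_smul]; rfl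

end BuchsbaumRim

section SymmetricSquare

set_option linter.unusedSectionVars false

variable {R : Type} [CommRing R] {n : Type} [Fintype n] [DecidableEq n]
  (A : Matrix (n ⊕ Fin 2) n R)

/-- The scalar multiples of the matrix of maximal minors. -/
def smulPM : R →ₗ[R] AltM R R (n ⊕ Fin 2) :=
  LinearMap.toSpanSingleton R _ ⟨PM A, PM_transpose A⟩

/-- The map `W ↦ Aᵀ W` on alternating matrices. -/
def altLeft : AltM R R (n ⊕ Fin 2) →ₗ[R] Matrix n (n ⊕ Fin 2) R :=
  lmul Aᵀ ∘ₗ (AltM R R (n ⊕ Fin 2)).subtype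

/-- The map `Y ↦ Y A + (Y A)ᵀ`. -/
def symRight : Matrix n (n ⊕ Fin 2) R →ₗ[R] SymM R R n :=
  toSym R R n ∘ₗ mulRightLinearMap n R A

lemma altLeft_apply (W : AltM R R (n ⊕ Fin 2)) : altLeft A W = Aᵀ * W.1 := rfl

lemma symRight_coe (Y : Matrix n (n ⊕ Fin 2) R) : (symRight A Y).1 = Y * A + (Y * A)ᵀ := rfl

lemma altLeft_smulPM (r : R) : altLeft A (smulPM A r) = 0 := by
  rw [altLeft_apply]
  change Aᵀ * (r • PM A) = 0
  rw [Matrix.mul_smul, transpose_mul_PM, smul_zero]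

lemma symRight_altLeft (W : AltM R R (n ⊕ Fin 2)) : symRight A (altLeft A W) = 0 := by
  apply Subtype.ext
  rw [symRight_coe, altLeft_apply, Matrix.transpose_mul, Matrix.transpose_mul,
    Matrix.transpose_transpose, mem_AltM.1 W.2, Matrix.neg_mul, Matrix.mul_neg, ← Matrix.mul_assoc,
    add_neg_cancel]
  rfl

variable [Invertible (2 : R)] [IsNoetherianRing R]

lemma smulPM_injective_and_dep (h3 : Dep (mI A) 3 R) :
    Function.Injective (smulPM A) ∧
      Dep (mI A) 2 (AltM R R (n ⊕ Fin 2) ⧸ LinearMap.range (smulPM A)) := by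
  refine Dep.acyclic_start rfl (Dep.mono h3 (by lia)).alt h3 ?_
  rintro r hr _ ⟨⟨i, j⟩, rfl⟩
  refine ⟨1, ?_⟩
  have : r * mm A i j = 0 := congrFun (congrFun (congrArg Subtype.val hr) i) j
  rw [pow_one, smul_eq_mul, mul_comm, this]

lemma altLeft_exact_and_dep (h3 : Dep (mI A) 3 R) :
    Function.Exact (smulPM A) (altLeft A) ∧
      Dep (mI A) 1 (Matrix n (n ⊕ Fin 2) R ⧸ LinearMap.range (altLeft A)) := by
  refine Dep.acyclic_step rfl (altLeft_smulPM A) (Dep.mono h3 (by lia)).matrix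
    (smulPM_injective_and_dep A h3).2 ?_
  rintro W hW _ ⟨⟨i, j⟩, rfl⟩
  set μ := mm A i j with hμ
  set W' := μ • W - smulPM A (W.1 i j) with hW'
  have hAW : Aᵀ * W'.1 = 0 := by
    rw [← altLeft_apply, hW', map_sub, map_smul, hW, altLeft_smulPM, smul_zero, sub_zero]
  have hDW : (A * DM A i j)ᵀ * W'.1 = 0 := by
    rw [Matrix.transpose_mul, Matrix.mul_assoc, hAW, Matrix.mul_zero]
  have hij : W'.1 i j = 0 := by
    change μ * W.1 i j - W.1 i j * mm A i j = 0
    rw [mul_comm, sub_self]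
  have hji : W'.1 j i = 0 := by rw [AltM.apply_comm, hij, neg_zero]
  have hrow : ∀ a, W'.1 i a = 0 → W'.1 j a = 0 → ∀ h, μ * W'.1 h a = 0 := by
    intro a hi hj h
    by_cases h1 : h = i
    · rw [h1, hi, mul_zero]
    by_cases h2 : h = j
    · rw [h2, hj, mul_zero]
    refine Eq.trans ?_ (congrFun (congrFun hDW h) a)
    rw [Matrix.mul_apply, Finset.sum_eq_single h]
    · rw [Matrix.transpose_apply, mul_DM A i j h h h1 h2, if_pos rfl]
    · intro x _ hx
      by_cases h3 : x = i
      · rw [h3, hi, mul_zero]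
      by_cases h4 : x = j
      · rw [h4, hj, mul_zero]
      rw [Matrix.transpose_apply, mul_DM A i j x h h3 h4, if_neg hx, zero_mul]
    · simp
  have hci := hrow i (AltM.apply_self W' i) hji
  have hcj := hrow j hij (AltM.apply_self W' j)
  have h0 : μ ^ 2 • W' = 0 := by
    apply Subtype.ext
    ext h a
    change μ ^ 2 * W'.1 h a = 0
    by_cases h1 : h = i
    · rw [h1, AltM.apply_comm, mul_neg, pow_two, mul_assoc, hci, mul_zero, neg_zero]
    by_cases h2 : h = j
    · rw [h2, AltM.apply_comm, mul_neg, pow_two, mul_assoc, hcj, mul_zero, neg_zero]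
    have h5 : μ * ((A * DM A i j)ᵀ * W'.1) h a = 0 := by rw [hDW, Matrix.zero_apply, mul_zero]
    rw [← h5, Matrix.mul_apply, Finset.mul_sum, Finset.sum_eq_single h]
    · rw [Matrix.transpose_apply, mul_DM A i j h h h1 h2, if_pos rfl, pow_two, mul_assoc]
    · intro x _ hx
      by_cases h3 : x = i
      · rw [h3, mul_left_comm, AltM.apply_comm, mul_neg, hci, neg_zero, mul_zero]
      by_cases h4 : x = j
      · rw [h4, mul_left_comm, AltM.apply_comm, mul_neg, hcj, neg_zero, mul_zero]
      rw [Matrix.transpose_apply, mul_DM A i j x h h3 h4, if_neg hx, zero_mul, mul_zero]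
    · simp
  refine ⟨3, μ ^ 2 • W.1 i j, ?_⟩
  rw [hW', smul_sub, sub_eq_zero] at h0
  rw [map_smul, ← h0, smul_smul, ← pow_succ]

lemma symRight_exact (h3 : Dep (mI A) 3 R) : Function.Exact (altLeft A) (symRight A) := by
  refine Dep.exact_of_torsion rfl (symRight_altLeft A) (altLeft_exact_and_dep A h3).2 ?_
  rintro Y hY _ ⟨⟨i, j⟩, rfl⟩
  set μ := mm A i j with hμ
  have hK : (Y * A)ᵀ = -(Y * A) := by
    rw [eq_neg_iff_add_eq_zero, add_comm, ← symRight_coe, hY]; rfl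
  set D := DM A i j
  have hDA : D * A = μ • (1 : Matrix n n R) := DM_mul A i j
  have hAD : Aᵀ * Dᵀ = μ • (1 : Matrix n n R) := by
    rw [← Matrix.transpose_mul, hDA, Matrix.transpose_smul, Matrix.transpose_one]
  refine ⟨2, ⟨μ • (Dᵀ * Y - Yᵀ * D) - Dᵀ * (Y * A) * D, ?_⟩, ?_⟩
  · rw [mem_AltM]
    simp only [Matrix.transpose_sub, Matrix.transpose_smul, Matrix.transpose_mul,
      Matrix.transpose_transpose]
    rw [← Matrix.transpose_mul Y A, hK]
    simp only [Matrix.neg_mul, Matrix.mul_neg, ← Matrix.mul_assoc, smul_sub]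
    abel
  · rw [altLeft_apply]
    have h1 : Aᵀ * Yᵀ = -(Y * A) := by rw [← Matrix.transpose_mul, hK]
    have h2 : Aᵀ * (Dᵀ * (Y * A) * D) = μ • (Y * A * D) := by
      rw [← Matrix.mul_assoc, ← Matrix.mul_assoc, hAD, Matrix.smul_mul, Matrix.smul_mul,
        Matrix.one_mul]
    change Aᵀ * (μ • (Dᵀ * Y - Yᵀ * D) - Dᵀ * (Y * A) * D) = μ ^ 2 • Y
    rw [Matrix.mul_sub, Matrix.mul_smul, Matrix.mul_sub, ← Matrix.mul_assoc, ← Matrix.mul_assoc,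
      hAD, h1, h2, Matrix.smul_mul, Matrix.one_mul, Matrix.neg_mul, smul_sub, smul_neg, smul_smul,
      pow_two]
    abel

end SymmetricSquare

section SymmetricPower

variable {R : Type} [CommRing R] {M N : Type} [AddCommGroup M] [Module R M]
  [AddCommGroup N] [Module R N]

lemma exists_descend {P : Type} [AddCommGroup P] [Module R P] {p : P →ₗ[R] M}
    (hp : Function.Surjective p) (f : P →ₗ[R] N) (h : ∀ x, p x = 0 → f x = 0) :
    ∃ g : M →ₗ[R] N, ∀ x, g (p x) = f x := by
  refine ⟨(LinearMap.ker p).liftQ f h ∘ₗ (p.quotKerEquivOfSurjective hp).symm.toLinearMap,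
    fun x => ?_⟩
  have : (p.quotKerEquivOfSurjective hp).symm (p x) = Submodule.Quotient.mk x := by
    rw [LinearEquiv.symm_apply_eq]; rfl
  rw [LinearMap.comp_apply, LinearEquiv.coe_coe, this]
  exact Submodule.liftQ_apply _ _ _

lemma exists_descend₂ {P : Type} [AddCommGroup P] [Module R P] {p : P →ₗ[R] M}
    (hp : Function.Surjective p) (f : P →ₗ[R] P →ₗ[R] N) (h : ∀ x y, p x = 0 → f x y = 0)
    (h' : ∀ x y, p y = 0 → f x y = 0) :
    ∃ g : M →ₗ[R] M →ₗ[R] N, ∀ x y, g (p x) (p y) = f x y := by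
  obtain ⟨g, hg⟩ := exists_descend hp f fun x hx => LinearMap.ext fun y => h x y hx
  obtain ⟨g', hg'⟩ := exists_descend hp g.flip fun y hy => by
    ext x
    obtain ⟨x, rfl⟩ := hp x
    rw [LinearMap.flip_apply, hg, h' x y hy]; rfl
  exact ⟨g'.flip, fun x y => by rw [LinearMap.flip_apply, hg', LinearMap.flip_apply, hg]⟩

variable (R) in
/-- The product of two elements in the symmetric square, as a function. -/
def smFun (x y : M) : SymPow R M 2 :=
  Submodule.Quotient.mk (PiTensorProduct.tprod R ![x, y])

lemma smFun_comm (x y : M) : smFun R x y = smFun R y x := by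
  refine (Submodule.Quotient.eq _).2 (Submodule.subset_span ⟨Equiv.swap 0 1, ![x, y], ?_⟩)
  congr 2
  ext i
  fin_cases i <;> simp

lemma smFun_add (x x' y : M) : smFun R (x + x') y = smFun R x y + smFun R x' y := by
  have := (PiTensorProduct.tprod R (s := fun _ : Fin 2 => M)).cons_add ![y] x x'
  exact congrArg Submodule.Quotient.mk this

lemma smFun_smul (r : R) (x y : M) : smFun R (r • x) y = r • smFun R x y := by
  have := (PiTensorProduct.tprod R (s := fun _ : Fin 2 => M)).cons_smul ![y] r x
  exact congrArg Submodule.Quotient.mk this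

variable (R M) in
/-- The product of two elements in the symmetric square. -/
def sm : M →ₗ[R] M →ₗ[R] SymPow R M 2 :=
  LinearMap.mk₂ R (smFun R) smFun_add smFun_smul
    (fun x y y' => by simp only [smFun_comm x, smFun_add])
    (fun r x y => by simp only [smFun_comm x, smFun_smul])

lemma sm_comm (x y : M) : sm R M x y = sm R M y x := smFun_comm x y

lemma sm_hom_ext {f g : SymPow R M 2 →ₗ[R] N} (h : ∀ x y, f (sm R M x y) = g (sm R M x y)) :
    f = g := by
  refine Submodule.linearMap_qext _ (PiTensorProduct.ext (MultilinearMap.ext fun v => ?_))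
  have hv : v = ![v 0, v 1] := by ext i; fin_cases i <;> rfl
  rw [hv]
  exact h (v 0) (v 1)

/-- The multilinear map attached to a bilinear map. -/
def multilinOfBilin (f : M →ₗ[R] M →ₗ[R] N) : MultilinearMap R (fun _ : Fin 2 => M) N where
  toFun v := f (v 0) (v 1)
  map_update_add' v i x y := by
    fin_cases i <;> simp
  map_update_smul' v i r x := by
    fin_cases i <;> simp

lemma exists_sm_lift (f : M →ₗ[R] M →ₗ[R] N) (hf : ∀ x y, f x y = f y x) :
    ∃ g : SymPow R M 2 →ₗ[R] N, ∀ x y, g (sm R M x y) = f x y := by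
  refine ⟨Submodule.liftQ _ (PiTensorProduct.lift (multilinOfBilin f)) ?_, fun x y => ?_⟩
  · rw [Submodule.span_le]
    rintro _ ⟨σ, v, rfl⟩
    rw [SetLike.mem_coe, LinearMap.mem_ker, map_sub, PiTensorProduct.lift.tprod,
      PiTensorProduct.lift.tprod, sub_eq_zero]
    change f (v 0) (v 1) = f (v (σ 0)) (v (σ 1))
    have hσ : σ = 1 ∨ σ = Equiv.swap 0 1 := by
      revert σ; decide
    rcases hσ with rfl | rfl
    · rfl
    · rw [Equiv.swap_apply_left, Equiv.swap_apply_right, hf]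
  · refine (Submodule.liftQ_apply _ _ _).trans ?_
    exact PiTensorProduct.lift.tprod _

end SymmetricPower

section Cokernel

set_option linter.unusedSectionVars false

variable {R : Type} [CommRing R] {n : Type} [Fintype n] [DecidableEq n]
  (A : Matrix (n ⊕ Fin 2) n R) {M : Type} [AddCommGroup M] [Module R M] (π : (n → R) →ₗ[R] M)

/-- The generators of the cokernel. -/
def ee (l : n) : M := π (Pi.single l 1)

lemma apply_eq_sum_ee (x : n → R) : π x = ∑ l, x l • ee π l := by
  conv_lhs => rw [pi_eq_sum_univ' x]
  rw [map_sum]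
  refine Finset.sum_congr rfl fun l _ => ?_
  rw [map_smul]; rfl

variable {π} (hex : Function.Exact Aᵀ.mulVecLin π)
include hex

lemma sum_smul_ee (h : n ⊕ Fin 2) : ∑ l, A h l • ee π l = 0 := by
  rw [← apply_eq_sum_ee π (A h)]
  refine (hex _).2 ⟨Pi.single h 1, ?_⟩
  rw [Matrix.mulVecLin_apply, Matrix.mulVec_single_one]; rfl

lemma mm_smul_ee (i j : n ⊕ Fin 2) (l : n) : mm A i j • ee π l = 0 := by
  have : π (Aᵀ.mulVecLin (fun h => nn A l i j h)) = 0 := (hex _).2 ⟨_, rfl⟩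
  rw [← this, ee, ← map_smul]
  congr 1
  ext l'
  refine Eq.trans ?_ (sum_mul_nn A l l' i j).symm
  simp [Pi.single_apply]

lemma nn_smul_ee (i j k : n ⊕ Fin 2) (l l' : n) :
    nn A l i j k • ee π l' = nn A l' i j k • ee π l := by
  have : π (Aᵀ.mulVecLin (fun h => nn2 A l l' i j k h)) = 0 := (hex _).2 ⟨_, rfl⟩
  rw [← sub_eq_zero, ← this, ee, ee, ← map_smul, ← map_smul, ← map_sub]
  congr 1
  ext l''
  refine Eq.trans ?_ (sum_mul_nn2 A l l' l'' i j k).symm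
  simp [Pi.single_apply]

variable (hπ : Function.Surjective π)
include hπ

lemma smul_eq_zero_of_mem_mI {r : R} (hr : r ∈ mI A) (x : M) : r • x = 0 := by
  obtain ⟨x, rfl⟩ := hπ x
  suffices h : mI A ≤ LinearMap.ker (LinearMap.toSpanSingleton R M (π x)) from h hr
  rw [mI, Ideal.span_le]
  rintro _ ⟨p, rfl⟩
  change mm A p.1 p.2 • π x = 0
  rw [apply_eq_sum_ee, Finset.smul_sum]
  refine Finset.sum_eq_zero fun l _ => ?_
  rw [smul_comm, mm_smul_ee A hex, smul_zero]

lemma exists_psi (i j k : n ⊕ Fin 2) : ∃ ψ : SymPow R M 2 →ₗ[R] M,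
    ∀ l x, ψ (sm R M (ee π l) x) = nn A l i j k • x := by
  let c : (n → R) →ₗ[R] R := Fintype.linearCombination R (fun l => nn A l i j k)
  have hc : ∀ x, c x = ∑ l, x l * nn A l i j k := fun x => rfl
  let f : (n → R) →ₗ[R] (n → R) →ₗ[R] M := (LinearMap.lsmul R _).flip π ∘ₗ c
  have hf : ∀ x y, f x y = c x • π y := fun x y => rfl
  have hs : ∀ x y, f x y = f y x := by
    intro x y
    rw [hf, hf, hc, hc, apply_eq_sum_ee π x, apply_eq_sum_ee π y, Finset.sum_smul, Finset.sum_smul]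
    simp only [Finset.smul_sum]
    rw [Finset.sum_comm]
    refine Finset.sum_congr rfl fun l _ => Finset.sum_congr rfl fun l' _ => ?_
    have h := nn_smul_ee A hex i j k l' l
    calc _ = (x l' * y l) • nn A l' i j k • ee π l := by simp only [smul_smul]; congr 1; ring
      _ = (x l' * y l) • nn A l i j k • ee π l' := by rw [h]
      _ = _ := by simp only [smul_smul]; congr 1; ring
  have h0 : ∀ x y, π y = 0 → f x y = 0 := fun x y hy => by rw [hf, hy, smul_zero]
  obtain ⟨g, hg⟩ := exists_descend₂ hπ f (fun x y hx => by rw [hs, h0 y x hx]) h0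
  obtain ⟨ψ, hψ⟩ := exists_sm_lift g (fun x y => by
    obtain ⟨x, rfl⟩ := hπ x
    obtain ⟨y, rfl⟩ := hπ y
    rw [hg, hg, hs])
  refine ⟨ψ, fun l x => ?_⟩
  obtain ⟨x, rfl⟩ := hπ x
  rw [hψ, ee, hg, hf, hc]
  simp [Pi.single_apply]

end Cokernel

section SymmetricSquarePresentation

set_option linter.unusedSectionVars false

variable {R : Type} [CommRing R] {n : Type} [Fintype n] [DecidableEq n]
  {A : Matrix (n ⊕ Fin 2) n R} {M : Type} [AddCommGroup M] [Module R M] (π : (n → R) →ₗ[R] M)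

/-- The map `Q ↦ ∑ Q_{i, j} e_i e_j` to the symmetric square. -/
def kap : Matrix n n R →ₗ[R] SymPow R M 2 where
  toFun Q := ∑ l, ∑ l', Q l l' • sm R M (ee π l) (ee π l')
  map_add' Q Q' := by simp [add_smul, Finset.sum_add_distrib]
  map_smul' r Q := by simp [mul_smul, Finset.smul_sum]

lemma kap_apply (Q : Matrix n n R) :
    kap π Q = ∑ l, ∑ l', Q l l' • sm R M (ee π l) (ee π l') := rfl

lemma kap_vecMulVec (x y : n → R) : kap π (vecMulVec x y) = sm R M (π x) (π y) := by
  rw [kap_apply, apply_eq_sum_ee π x, apply_eq_sum_ee π y]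
  simp only [map_sum, LinearMap.sum_apply, map_smul, LinearMap.smul_apply, Finset.smul_sum,
    smul_smul,
    vecMulVec_apply]
  rw [Finset.sum_comm]
  exact Finset.sum_congr rfl fun _ _ => Finset.sum_congr rfl fun _ _ => by rw [mul_comm]

lemma kap_transpose (Q : Matrix n n R) : kap π Qᵀ = kap π Q := by
  rw [kap_apply, kap_apply, Finset.sum_comm]
  exact Finset.sum_congr rfl fun _ _ => Finset.sum_congr rfl fun _ _ => by
    rw [sm_comm, Matrix.transpose_apply]

lemma matrix_eq_sum_vecMulVec (Q : Matrix n n R) :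
    Q = ∑ l, ∑ l', Q l l' • vecMulVec (Pi.single l 1) (Pi.single l' 1) := by
  ext a b
  simp [Matrix.sum_apply, vecMulVec_apply, Pi.single_apply]

variable {π} (hex : Function.Exact Aᵀ.mulVecLin π)

include hex in
lemma kap_mul (Y : Matrix n (n ⊕ Fin 2) R) : kap π (Y * A) = 0 := by
  rw [kap_apply]
  refine Finset.sum_eq_zero fun l _ => ?_
  have : ∑ l', (Y * A) l l' • ee π l' = 0 := by
    simp only [Matrix.mul_apply, Finset.sum_smul, mul_smul]
    rw [Finset.sum_comm]
    refine Finset.sum_eq_zero fun h _ => ?_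
    rw [← Finset.smul_sum, sum_smul_ee A hex, smul_zero]
  rw [← map_zero (sm R M (ee π l)), ← this, map_sum]
  exact Finset.sum_congr rfl fun _ _ => (map_smul _ _ _).symm

variable (hπ : Function.Surjective π) [Invertible (2 : R)]
include hex hπ

/-- The presentation of the symmetric square. -/
lemma exists_symPow_equiv :
    ∃ e : SymPow R M 2 ≃ₗ[R] SymM R R n ⧸ LinearMap.range (symRight A),
      ∀ Q : SymM R R n, e (kap π Q.1) = Submodule.Quotient.mk Q := by
  let q := (LinearMap.range (symRight A)).mkQ ∘ₗ ((⅟2 : R) • toSym R R n)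
  have hq : ∀ Q, q Qᵀ = q Q := fun Q => by
    have : toSym R R n Qᵀ = toSym R R n Q := Subtype.ext (add_comm _ _)
    simp only [q, LinearMap.comp_apply, LinearMap.smul_apply, this]
  have hqS : ∀ Q : SymM R R n, q Q.1 = Submodule.Quotient.mk Q := fun Q => by
    have := LinearMap.congr_fun (toSym_half (R := R) (N := R) (a := n)) Q
    refine congrArg Submodule.Quotient.mk (Eq.trans ?_ this)
    exact (map_smul (toSym R R n) _ _).symm
  let f : (n → R) →ₗ[R] (n → R) →ₗ[R] _ := (vecMulVecBilin R R).compr₂ q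
  have hf : ∀ x y, f x y = q (vecMulVec x y) := fun x y => rfl
  have hs : ∀ x y, f x y = f y x := fun x y => by
    rw [hf, hf, ← hq, transpose_vecMulVec]
  have h0 : ∀ x y, π y = 0 → f x y = 0 := fun x y hy => by
    obtain ⟨z, rfl⟩ := (hex _).1 hy
    have : vecMulVec x (Aᵀ.mulVecLin z) = vecMulVec x z * A := by
      rw [Matrix.mulVecLin_apply, Matrix.mulVec_transpose, vecMulVec_mul]
    rw [hf, this]
    refine (Submodule.Quotient.mk_eq_zero _).2 ⟨(⅟2 : R) • vecMulVec x z, ?_⟩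
    rw [map_smul]; rfl
  obtain ⟨g, hg⟩ := exists_descend₂ hπ f (fun x y hx => by rw [hs, h0 y x hx]) h0
  obtain ⟨φ, hφ⟩ := exists_sm_lift g (fun x y => by
    obtain ⟨x, rfl⟩ := hπ x
    obtain ⟨y, rfl⟩ := hπ y
    rw [hg, hg, hs])
  let κ : SymM R R n ⧸ LinearMap.range (symRight A) →ₗ[R] SymPow R M 2 :=
    Submodule.liftQ _ (kap π ∘ₗ (SymM R R n).subtype) (by
      rintro _ ⟨Y, rfl⟩
      change kap π (symRight A Y).1 = 0
      rw [symRight_coe, map_add, kap_transpose, kap_mul hex, add_zero])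
  have hκ : ∀ Q : SymM R R n, κ (Submodule.Quotient.mk Q) = kap π Q.1 :=
    fun Q => Submodule.liftQ_apply _ _ _
  have h1 : ∀ Q, φ (kap π Q) = q Q := fun Q => by
    conv_rhs => rw [matrix_eq_sum_vecMulVec Q]
    simp only [kap_apply, map_sum, map_smul, hφ, ee, hg, hf]
  have h2 : ∀ Q, κ (q Q) = kap π Q := fun Q => by
    refine (hκ _).trans ?_
    change kap π ((⅟2 : R) • (Q + Qᵀ)) = _
    rw [map_smul, map_add, kap_transpose, eq_half]
  refine ⟨LinearEquiv.ofLinearMap φ κ ?_ ?_, fun Q => (h1 _).trans (hqS Q)⟩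
  · refine Submodule.linearMap_qext _ (LinearMap.ext fun Q => ?_)
    change φ (κ (Submodule.Quotient.mk Q)) = _
    rw [hκ, h1, hqS]; rfl
  · refine sm_hom_ext fun x y => ?_
    obtain ⟨x, rfl⟩ := hπ x
    obtain ⟨y, rfl⟩ := hπ y
    change κ (φ _) = sm R M (π x) (π y)
    rw [hφ, hg, hf, h2, kap_vecMulVec]

variable [IsNoetherianRing R] (h3 : Dep (mI A) 3 R)
include h3

lemma dep_symPow {J : Ideal R} {d : ℕ} (h : Dep J (d + 3) R) : Dep J d (SymPow R M 2) := by
  obtain ⟨e, -⟩ := exists_symPow_equiv hex hπ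
  refine Dep.equiv ?_ e
  refine Dep.coker_range (symRight_exact A h3) (Dep.mono h (by lia)).sym ?_
  refine Dep.coker_range (altLeft_exact_and_dep A h3).1 (Dep.mono h (by lia)).matrix ?_
  exact Dep.coker (smulPM_injective_and_dep A h3).1 (Submodule.mkQ_surjective _)
    (LinearMap.exact_map_mkQ_range _) (Dep.mono h (by lia)).alt h

omit [Invertible (2 : R)] in
lemma dep_cokernel {J : Ideal R} {d : ℕ} (h : Dep J (d + 3) R) : Dep J d M := by
  have hk : LinearMap.range Aᵀ.mulVecLin = LinearMap.ker π := (LinearMap.exact_iff.1 hex).symm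
  refine Dep.equiv ?_ ((Submodule.quotEquivOfEq _ _ hk).trans
    (π.quotKerEquivOfSurjective hπ)).symm
  refine Dep.coker_range (transpose_exact A h3) (Dep.mono h (by lia)).pi ?_
  refine Dep.coker_range (PM_exact_and_dep A h3).1 (Dep.mono h (by lia)).pi ?_
  exact Dep.coker (mulVec_injective_and_dep A h3).1 (Submodule.mkQ_surjective _)
    (LinearMap.exact_map_mkQ_range _) (Dep.mono h (by lia)).pi h.pi

end SymmetricSquarePresentation

section Kernel

variable {R : Type} [CommRing R] {n : Type} [Fintype n] [DecidableEq n]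

lemma mm_map {S : Type} [CommRing S] (f : R →+* S) (A : Matrix (n ⊕ Fin 2) n R)
    (i j : n ⊕ Fin 2) : mm (A.map f) i j = f (mm A i j) := by
  rw [mm, mm, RingHom.map_det]
  congr 1
  ext a b
  rcases a with a | a
  · rfl
  · have key : ∀ k, (Pi.single k 1 : n ⊕ Fin 2 → S) b = f ((Pi.single k 1 : n ⊕ Fin 2 → R) b) :=
      fun k => by rw [Pi.single_apply, Pi.single_apply, apply_ite f, map_one, map_zero]
    fin_cases a
    · exact key i
    · exact key j

lemma exists_mulVec_eq_zero_of_mm {K : Type} [Field K] (A : Matrix (n ⊕ Fin 2) n K)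
    (h : ∀ i j, mm A i j = 0) : ∃ v ≠ 0, A *ᵥ v = 0 := by
  by_contra! hA
  have hinj : LinearMap.ker A.mulVecLin = ⊥ := by
    rw [Submodule.eq_bot_iff]
    intro v hv
    by_contra hv0
    exact hA v hv0 hv
  have hrank :
      Module.finrank K (Submodule.span K (Set.range A.row)) = Module.finrank K (n → K) := by
    rw [← Matrix.rank_eq_finrank_span_row, Matrix.rank,
      LinearMap.finrank_range_of_inj (LinearMap.ker_eq_bot.1 hinj)]
  have htop := Submodule.eq_top_of_finrank_eq hrank
  obtain ⟨κ, r, hr, hspan, hli⟩ := exists_linearIndependent' K A.row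
  let b : Module.Basis κ K (n → K) := .mk hli (by rw [hspan, htop])
  let e : n ≃ κ := (Pi.basisFun K n).indexEquiv b
  have hu : IsUnit (A.submatrix (r ∘ e) id) :=
    Matrix.linearIndependent_rows_iff_isUnit.1 (hli.comp e e.injective)
  have := det_submatrix_mem_of_mm A ⊥ (fun i j => h i j) (r ∘ e) id (hr.comp e.injective)
    Function.injective_id
  exact ((Matrix.isUnit_iff_isUnit_det _).1 hu).ne_zero this

lemma exists_mulVec_mem_prime (A : Matrix (n ⊕ Fin 2) n R) (p : Ideal R) [p.IsPrime]
    (h : mI A ≤ p) : ∃ v : n → R, (∃ l, v l ∉ p) ∧ ∀ i, (A *ᵥ v) i ∈ p := by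
  let K := FractionRing (R ⧸ p)
  let f : R →+* K := (algebraMap (R ⧸ p) K).comp (Ideal.Quotient.mk p)
  have hf : ∀ x, f x = 0 ↔ x ∈ p := fun x => by
    rw [← Ideal.Quotient.eq_zero_iff_mem, ← map_eq_zero_iff _ (IsFractionRing.injective (R ⧸ p) K)]
    rfl
  obtain ⟨w, hw0, hw⟩ := exists_mulVec_eq_zero_of_mm (A.map f) fun i j => by
    rw [mm_map, hf]
    exact h (Ideal.subset_span ⟨(i, j), rfl⟩)
  obtain ⟨b, hb⟩ := IsLocalization.exist_integer_multiples_of_finite (nonZeroDivisors (R ⧸ p)) w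
  have hv : ∀ l, ∃ v, f v = (b : R ⧸ p) • w l := fun l => by
    obtain ⟨v, hv⟩ := hb l
    obtain ⟨v, rfl⟩ := Ideal.Quotient.mk_surjective v
    exact ⟨v, hv⟩
  choose v hv using hv
  have hfv : f ∘ v = (b : R ⧸ p) • w := funext hv
  refine ⟨v, ?_, fun i => ?_⟩
  · by_contra! hl
    refine hw0 (funext fun l => ?_)
    have h1 := hv l
    rw [(hf _).2 (hl l)] at h1
    exact (smul_eq_zero.1 h1.symm).resolve_left (nonZeroDivisors.ne_zero b.2)
  · rw [← hf, RingHom.map_mulVec, hfv, Matrix.mulVec_smul, hw, smul_zero]; rfl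

end Kernel

section Bootstrap

variable {R : Type} [CommRing R] {n : Type} [Fintype n] [DecidableEq n] [IsNoetherianRing R]
  [Invertible (2 : R)] (A : Matrix (n ⊕ Fin 2) n R) {J : Ideal R} (hJ : mI A ≤ J)
  (h3 : Dep (mI A) 3 R)
include hJ h3

omit hJ in
lemma dep_coker_symMul {g : ℕ} (h1 : Dep J (g + 3) R) (h2 : Dep J (g + 1) (R ⧸ mI A)) :
    Dep J (g + 3) (Matrix (n ⊕ Fin 2) n R ⧸ LinearMap.range (symMul A (N := R))) := by
  have hI : Dep J (g + 2) (mI A) :=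
    Dep.ker (f := (mI A).subtype) (Submodule.subtype_injective _) (Submodule.mkQ_surjective _)
      (LinearMap.exact_subtype_mkQ (mI A)) (Dep.mono h1 (by lia)) h2
  have hk : LinearMap.range (symMul A (N := R)) = LinearMap.ker (altMul A) :=
    (LinearMap.exact_iff.1 (altMul_exact_and_dep A h3).1).symm
  let φ := Submodule.liftQ (LinearMap.range (symMul A (N := R))) (altMul A) hk.le
  have hφ : Function.Injective φ := by
    rw [← LinearMap.ker_eq_bot, Submodule.ker_liftQ, ← hk, Submodule.mkQ_map_self]
  refine Dep.ker hφ (altSum_surjective A) ?_ h1.alt hI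
  rw [LinearMap.exact_iff, Submodule.range_liftQ]
  exact LinearMap.exact_iff.1 (altSum_exact A h3)

lemma dep_succ {g : ℕ} (h1 : Dep J (g + 3) R) (h2 : Dep J (g + 1) (R ⧸ mI A)) :
    Dep J (g + 4) R := by
  have hinj : Function.Injective (push J (g + 2 + 1) (symMul A (N := R))) :=
    push_injective (symMul_injective_and_dep A h3).1 (Submodule.mkQ_surjective _)
      (LinearMap.exact_map_mkQ_range _) _ (dep_coker_symMul A h3 h1 h2 _ (by lia))
  suffices hs : Subsingleton (ExtQ J R (g + 3)) by
    intro i hi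
    rcases Nat.lt_succ_iff_lt_or_eq.1 hi with hi | rfl
    · exact h1 i hi
    · exact hs
  refine subsingleton_of_forall_eq 0 fun x => ?_
  by_contra hx
  obtain ⟨p, hp, -⟩ := exists_le_isAssociatedPrime_of_isNoetherianRing R x hx
  obtain ⟨hp, e, he⟩ := (isAssociatedPrime_iff ..).1 hp
  have hpe : ∀ r, r ∈ p ↔ r • e = 0 := fun r => by
    rw [he, Submodule.mem_colon_singleton, Submodule.mem_bot]
  obtain ⟨v, ⟨l, hl⟩, hv⟩ := exists_mulVec_mem_prime A p fun r hr =>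
    (hpe r).2 (smul_extQ_eq_zero _ (hJ hr) e)
  let q : R →ₗ[R] SymM R R n := LinearMap.toSpanSingleton R _
    ⟨vecMulVec v v, transpose_vecMulVec v v⟩
  have h0 : push J (g + 3) (symMul A ∘ₗ q) e = 0 := by
    have : symMul A ∘ₗ q = ∑ h, ∑ l, ((A *ᵥ v) h * v l) •
        LinearMap.toSpanSingleton R (Matrix (n ⊕ Fin 2) n R) (Matrix.single h l 1) := by
      refine LinearMap.ext_ring ?_
      have h1 : (symMul A ∘ₗ q) 1 = A * vecMulVec v v := by
        change lmul A ((1 : R) • vecMulVec v v) = _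
        rw [one_smul]; rfl
      rw [h1, mul_vecMulVec]
      ext a b
      simp [LinearMap.sum_apply, Matrix.sum_apply, vecMulVec_apply, Matrix.single_apply,
        ite_and, -Fintype.sum_sum_type]
    rw [this, push_sum]
    refine Finset.sum_eq_zero fun h _ => ?_
    rw [push_sum]
    refine Finset.sum_eq_zero fun l _ => ?_
    rw [push_smul, ← map_smul, (hpe _).1 (p.mul_mem_right _ (hv h)), map_zero]
  have h1 : push J (g + 3) q e = 0 := by
    apply hinj
    rw [map_zero]
    exact (push_push ..).trans h0
  let ε : SymM R R n →ₗ[R] R := LinearMap.proj l ∘ₗ LinearMap.proj l ∘ₗ (SymM R R n).subtype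
  have h2 : ε ∘ₗ q = (v l * v l) • LinearMap.id := by
    refine LinearMap.ext_ring ?_
    change (1 : R) • (v l * v l) = (v l * v l) * 1
    rw [one_smul, mul_one]
  have h3 : (v l * v l) • e = 0 := by
    have := push_push (g + 3) q ε e
    rw [h1, map_zero, h2, push_smul, push_id] at this
    exact this.symm
  exact (hp.mem_or_mem ((hpe _).2 h3)).elim hl hl

lemma dep_eight (h : Dep J 3 R) (h5 : Dep J 5 (R ⧸ mI A)) : Dep J 8 R :=
  dep_succ A hJ h3 (dep_succ A hJ h3 (dep_succ A hJ h3 (dep_succ A hJ h3 (dep_succ A hJ h3 h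
    (h5.mono (by lia))) (h5.mono (by lia))) (h5.mono (by lia))) (h5.mono (by lia))) h5

end Bootstrap

section Complex

set_option linter.unusedSectionVars false

variable {R : Type} [CommRing R] {M : Type} [AddCommGroup M] [Module R M]

/-- The product of a matrix over `R` and a vector with entries in an `R`-module. -/
def vmul {a b : Type} [Fintype b] (B : Matrix a b R) : (b → M) →ₗ[R] (a → M) where
  toFun u h := ∑ l, B h l • u l
  map_add' u v := by ext; simp [Finset.sum_add_distrib]
  map_smul' r u := by ext; simp [Finset.smul_sum, smul_comm r]

lemma vmul_apply {a b : Type} [Fintype b] (B : Matrix a b R) (u : b → M) (h : a) :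
    vmul B u h = ∑ l, B h l • u l := rfl

variable {n : Type} [Fintype n] [DecidableEq n]
  {A : Matrix (n ⊕ Fin 2) n R} {π : (n → R) →ₗ[R] M}

variable (π) in
/-- The products of the entries of a vector with the generators. -/
def outer {a : Type} : (a → M) →ₗ[R] Matrix a n (SymPow R M 2) where
  toFun w := Matrix.of fun h l => sm R M (ee π l) (w h)
  map_add' u v := by ext; simp
  map_smul' r u := by ext; simp

lemma outer_apply {a : Type} (w : a → M) (h : a) (l : n) :
    outer π w h l = sm R M (ee π l) (w h) := rfl

lemma lmul_outer {a b : Type} [Fintype b] (B : Matrix a b R) (u : b → M) :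
    lmul B (outer π u) = outer π (vmul B u) := by
  ext h l
  simp [lmul_apply, outer_apply, vmul_apply]

variable (A π) in
/-- The map `u ↦ (u eᵀ + e uᵀ, -A u)`. -/
def cxFive : (n → M) →ₗ[R] SymM R (SymPow R M 2) n × (n ⊕ Fin 2 → M) :=
  LinearMap.prod (toSym R _ n ∘ₗ outer π) (-vmul A)

variable (A π) in
/-- The map `(Q, w) ↦ A Q + w eᵀ`. -/
def cxFour : SymM R (SymPow R M 2) n × (n ⊕ Fin 2 → M) →ₗ[R]
    Matrix (n ⊕ Fin 2) n (SymPow R M 2) :=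
  LinearMap.coprod (symMul A) (outer π)

lemma cxFour_apply (Q : SymM R (SymPow R M 2) n) (w : n ⊕ Fin 2 → M) :
    cxFour A π (Q, w) = lmul A Q.1 + outer π w := rfl

variable (ψ : n ⊕ Fin 2 → n ⊕ Fin 2 → n ⊕ Fin 2 → SymPow R M 2 →ₗ[R] M)

/-- The map from matrices with entries in the symmetric square given by the maps `ψ i j k`. -/
def cxTwoAux : Matrix (n ⊕ Fin 2) (n ⊕ Fin 2) (SymPow R M 2) →ₗ[R] (n ⊕ Fin 2 → M) where
  toFun W k := ∑ a, ∑ b, ψ a b k (W a b)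
  map_add' u v := by ext; simp [Finset.sum_add_distrib]
  map_smul' r u := by ext; simp [Finset.smul_sum]

lemma cxTwoAux_apply (W : Matrix (n ⊕ Fin 2) (n ⊕ Fin 2) (SymPow R M 2)) (k : n ⊕ Fin 2) :
    cxTwoAux ψ W k = ∑ a, ∑ b, ψ a b k (W a b) := rfl

/-- The restriction of `cxTwoAux` to alternating matrices. -/
def cxTwo : AltM R (SymPow R M 2) (n ⊕ Fin 2) →ₗ[R] (n ⊕ Fin 2 → M) :=
  cxTwoAux ψ ∘ₗ (AltM R (SymPow R M 2) (n ⊕ Fin 2)).subtype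

lemma cxTwoAux_single (i j k : n ⊕ Fin 2) (s : SymPow R M 2) :
    cxTwoAux ψ (Matrix.single i j s) k = ψ i j k s := by
  rw [cxTwoAux_apply, Finset.sum_eq_single i, Finset.sum_eq_single j, Matrix.single_apply_same]
  · intro b _ hb
    rw [Matrix.single_apply_of_col_ne _ _ hb.symm, map_zero]
  · simp
  · intro a _ ha
    refine Finset.sum_eq_zero fun b _ => ?_
    rw [Matrix.single_apply_of_row_ne ha.symm, map_zero]
  · simp

variable {ψ} (hex : Function.Exact Aᵀ.mulVecLin π) (hπ : Function.Surjective π)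

include hπ in
lemma sm_ee_hom_ext {N : Type} [AddCommGroup N] [Module R N] {f g : SymPow R M 2 →ₗ[R] N}
    (h : ∀ l x, f (sm R M (ee π l) x) = g (sm R M (ee π l) x)) : f = g := by
  refine sm_hom_ext fun x y => ?_
  obtain ⟨x, rfl⟩ := hπ x
  rw [apply_eq_sum_ee]
  simp [map_sum, h]

variable (hψ : ∀ i j k l x, ψ i j k (sm R M (ee π l) x) = nn A l i j k • x)

section Relations

include hπ hψ

lemma psi_swap₁₂ (i j k : n ⊕ Fin 2) : ψ j i k = -ψ i j k :=
  sm_ee_hom_ext hπ fun l x => by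
    rw [hψ, LinearMap.neg_apply, hψ, nn_swap₁₂, neg_smul]

lemma psi_cycle (i j k : n ⊕ Fin 2) : ψ j k i = ψ i j k :=
  sm_ee_hom_ext hπ fun l x => by rw [hψ, hψ, nn_cycle]

lemma psi_self₁₃ (i j : n ⊕ Fin 2) : ψ i j i = 0 :=
  sm_ee_hom_ext hπ fun l x => by rw [hψ, nn_self₁₃, zero_smul]; rfl

lemma psi_self₂₃ (i j : n ⊕ Fin 2) : ψ i j j = 0 :=
  sm_ee_hom_ext hπ fun l x => by rw [hψ, nn_self₂₃, zero_smul]; rfl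

lemma cxTwoAux_transpose (W : Matrix (n ⊕ Fin 2) (n ⊕ Fin 2) (SymPow R M 2)) :
    cxTwoAux ψ Wᵀ = -cxTwoAux ψ W := by
  ext k
  rw [Pi.neg_apply, cxTwoAux_apply, cxTwoAux_apply, Finset.sum_comm, ← Finset.sum_neg_distrib]
  refine Finset.sum_congr rfl fun a _ => ?_
  rw [← Finset.sum_neg_distrib]
  refine Finset.sum_congr rfl fun b _ => ?_
  rw [psi_swap₁₂ hπ hψ]; rfl

lemma cxTwo_toAlt (W : Matrix (n ⊕ Fin 2) (n ⊕ Fin 2) (SymPow R M 2)) :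
    cxTwo ψ (toAlt R _ _ W) = cxTwoAux ψ W + cxTwoAux ψ W := by
  change cxTwoAux ψ (W - Wᵀ) = _
  rw [map_sub, cxTwoAux_transpose hπ hψ, sub_neg_eq_add]

include hex

lemma sum_smul_psi (i j : n ⊕ Fin 2) (l : n) (s : SymPow R M 2) :
    ∑ h, A h l • ψ i j h s = 0 := by
  suffices hs : ∑ h, A h l • ψ i j h = 0 by
    simpa using LinearMap.congr_fun hs s
  refine sm_ee_hom_ext hπ fun l' x => ?_
  simp only [LinearMap.sum_apply, LinearMap.smul_apply, hψ, smul_smul, ← Finset.sum_smul,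
    sum_mul_nn]
  split_ifs with hl
  · exact smul_eq_zero_of_mem_mI A hex hπ (Ideal.subset_span ⟨(i, j), rfl⟩) x
  · exact zero_smul _ _

lemma sm_ee_psi (i j k : n ⊕ Fin 2) (l : n) (s : SymPow R M 2) :
    sm R M (ee π l) (ψ i j k s) = nn A l i j k • s := by
  suffices hs : sm R M (ee π l) ∘ₗ ψ i j k = nn A l i j k • LinearMap.id from
    LinearMap.congr_fun hs s
  refine sm_ee_hom_ext hπ fun l' x => ?_
  change sm R M (ee π l) (ψ i j k _) = nn A l i j k • sm R M (ee π l') x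
  rw [hψ, map_smul, ← LinearMap.map_smul₂, nn_smul_ee A hex, LinearMap.map_smul₂]

lemma outer_psi {a : Type} (i j k : n ⊕ Fin 2) (y : a → SymPow R M 2) (h : a) (l : n) :
    outer π (fun h => ψ i j k (y h)) h l = nn A l i j k • y h :=
  sm_ee_psi hex hπ hψ i j k l (y h)

end Relations

section Compositions

include hex

lemma cxFour_cxFive (u : n → M) : cxFour A π (cxFive A π u) = 0 := by
  change lmul A (outer π u + (outer π u)ᵀ) + outer π (-vmul A u) = 0
  have h : lmul A (outer π u)ᵀ = 0 := by
    ext h l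
    simp only [lmul_apply, Matrix.transpose_apply, outer_apply, ← LinearMap.map_smul₂]
    rw [← LinearMap.sum_apply, ← map_sum, sum_smul_ee A hex, map_zero]; rfl
  rw [map_add, h, map_neg, lmul_outer, add_zero, add_neg_cancel]

lemma altMul_outer (w : n ⊕ Fin 2 → M) : altMul A (outer π w) = 0 := by
  have h : lmul A (outer π w)ᵀ = 0 := by
    ext h l
    simp only [lmul_apply, Matrix.transpose_apply, outer_apply, ← LinearMap.map_smul₂]
    rw [← LinearMap.sum_apply, ← map_sum, sum_smul_ee A hex, map_zero]; rfl
  apply Subtype.ext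
  rw [altMul_coe, h, Matrix.transpose_zero, sub_zero]; rfl

lemma altMul_cxFour (z : SymM R (SymPow R M 2) n × (n ⊕ Fin 2 → M)) :
    altMul A (cxFour A π z) = 0 := by
  obtain ⟨Q, w⟩ := z
  change altMul A (symMul A Q + outer π w) = 0
  rw [map_add, altMul_symMul, altMul_outer hex, add_zero]

include hπ hψ

lemma cxTwo_altMul (Y : Matrix (n ⊕ Fin 2) n (SymPow R M 2)) : cxTwo ψ (altMul A Y) = 0 := by
  have h : cxTwoAux ψ (lmul A Yᵀ) = 0 := by
    ext k
    rw [cxTwoAux_apply, Finset.sum_comm]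
    refine Finset.sum_eq_zero fun b _ => ?_
    simp only [lmul_apply, map_sum, map_smul]
    rw [Finset.sum_comm]
    refine Finset.sum_eq_zero fun l _ => ?_
    rw [← sum_smul_psi hex hπ hψ b k l (Y b l)]
    exact Finset.sum_congr rfl fun h _ => by rw [← psi_cycle hπ hψ h b k]; rfl
  change cxTwoAux ψ (altMul A Y).1 = 0
  rw [altMul_coe, map_sub, cxTwoAux_transpose hπ hψ, h, neg_zero, sub_zero]

lemma vmul_cxTwo (W : AltM R (SymPow R M 2) (n ⊕ Fin 2)) : vmul Aᵀ (cxTwo ψ W) = 0 := by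
  ext l
  change ∑ h, A h l • ∑ a, ∑ b, ψ a b h (W.1 a b) = 0
  simp only [Finset.smul_sum]
  rw [Finset.sum_comm]
  refine Finset.sum_eq_zero fun a _ => ?_
  rw [Finset.sum_comm]
  exact Finset.sum_eq_zero fun b _ => sum_smul_psi hex hπ hψ a b l _

end Compositions

end Complex

section Torsion

set_option linter.unusedSectionVars false

variable {R : Type} [CommRing R] {M : Type} [AddCommGroup M] [Module R M]
  {n : Type} [Fintype n] [DecidableEq n]
  {A : Matrix (n ⊕ Fin 2) n R} {π : (n → R) →ₗ[R] M}
  {ψ : n ⊕ Fin 2 → n ⊕ Fin 2 → n ⊕ Fin 2 → SymPow R M 2 →ₗ[R] M}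
  (hex : Function.Exact Aᵀ.mulVecLin π) (hπ : Function.Surjective π)
  (hψ : ∀ i j k l x, ψ i j k (sm R M (ee π l) x) = nn A l i j k • x)
  [Invertible (2 : R)]

lemma mem_of_add_self_mem {N : Type} [AddCommGroup N] [Module R N] {P : Submodule R N} {x : N}
    (h : x + x ∈ P) : x ∈ P := by
  rw [← eq_half (R := R) x]
  exact P.smul_mem _ h

/-- The matrix of minors of `A` of corank two completing the column `p`. -/
def NM (A : Matrix (n ⊕ Fin 2) n R) (p : n) (i j k : n ⊕ Fin 2) : Matrix n (n ⊕ Fin 2) R :=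
  Matrix.of fun l h => nn2 A p l i j k h

lemma lmul_NM_lmul {N : Type} [AddCommGroup N] [Module R N] {c : Type} (p : n)
    (i j k : n ⊕ Fin 2) (X : Matrix n c N) (l : n) (h : c) :
    lmul (NM A p i j k) (lmul A X) l h = nn A p i j k • X l h - nn A l i j k • X p h := by
  rw [← lmul_mul, lmul_apply]
  have : ∀ l', (NM A p i j k * A) l l' =
      (if l' = l then nn A p i j k else 0) - (if l' = p then nn A l i j k else 0) := fun l' => by
    rw [← sum_mul_nn2, Matrix.mul_apply]
    exact Finset.sum_congr rfl fun _ _ => mul_comm _ _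
  simp [this, sub_smul, ite_smul]

lemma sum_nn_mul_mem (h i j k : n ⊕ Fin 2) : ∑ l, A h l * nn A l i j k ∈ mI A := by
  have hm : ∀ i j, mm A i j ∈ mI A := fun i j => Ideal.subset_span ⟨(i, j), rfl⟩
  rw [sum_nn_mul]
  refine (mI A).sub_mem ((mI A).sub_mem ?_ ?_) ?_ <;> split_ifs <;> simp [hm]

include hex hπ hψ

lemma cxFive_torsion (u : n → M) (hu : cxFive A π u = 0) (p : n) (i j k : n ⊕ Fin 2) :
    ∃ e, nn A p i j k ^ e • u = 0 := by
  have h1 : ∀ l l', sm R M (ee π l') (u l) + sm R M (ee π l) (u l') = 0 := fun l l' =>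
    congrFun (congrFun (congrArg (fun z => z.1.1) hu) l) l'
  have h2 : ∀ l, nn A p i j k • u l + nn A l i j k • u p = 0 := fun l => by
    rw [← hψ, ← hψ, ← map_add, h1, map_zero]
  refine ⟨2, funext fun l => ?_⟩
  have h3 : nn A p i j k • u p = 0 := eq_zero_of_add_self (h2 p) R
  have h4 := congrArg (fun z => nn A p i j k • z) (h2 l)
  simp only [smul_add, smul_zero] at h4
  rwa [smul_comm _ (nn A l i j k), h3, smul_zero, add_zero, smul_smul, ← pow_two] at h4

lemma cxFour_torsion (z : SymM R (SymPow R M 2) n × (n ⊕ Fin 2 → M)) (hz : cxFour A π z = 0)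
    (p : n) (i j k : n ⊕ Fin 2) :
    ∃ e, nn A p i j k ^ e • z ∈ LinearMap.range (cxFive A π) := by
  obtain ⟨Q, w⟩ := z
  set μ := nn A p i j k with hμ
  let u : n → M := fun l => ψ i j k (Q.1 l p)
  have hw : vmul A u = -(μ • w) := by
    ext h
    have h1 := congrArg (ψ i j k) (congrFun (congrFun hz h) p)
    rw [cxFour_apply, Matrix.add_apply, map_add, outer_apply, hψ, lmul_apply, map_sum] at h1
    simp only [map_smul] at h1
    exact eq_neg_of_add_eq_zero_left (h1.trans (map_zero _))
  obtain ⟨Q', hQ'⟩ : ∃ Q', μ • (Q, w) - cxFive A π u = (Q', 0) := by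
    refine ⟨_, Prod.ext rfl ?_⟩
    change μ • w - -(vmul A u) = 0
    rw [hw, neg_neg, sub_self]
  have hAQ : lmul A Q'.1 = 0 := by
    have := congrArg (cxFour A π) hQ'
    rw [map_sub, map_smul, hz, cxFour_cxFive hex, smul_zero, sub_zero, cxFour_apply, map_zero,
      add_zero] at this
    exact this.symm
  have h1 : ∀ l l', μ • Q'.1 l l' = nn A l i j k • Q'.1 p l' := fun l l' => by
    rw [← sub_eq_zero, ← lmul_NM_lmul, hAQ, map_zero]; rfl
  have h2 : ∀ l l', (μ ^ 2) • Q'.1 l l' = (nn A l i j k * nn A l' i j k) • Q'.1 p p :=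
    fun l l' => by
      rw [pow_two, mul_smul, h1, smul_comm, SymM.apply_comm Q' p l', h1, smul_smul]
  let v : n → M := fun l => nn A l i j k • ψ i j k (Q'.1 p p)
  have h3 : (μ ^ 2) • (Q', (0 : n ⊕ Fin 2 → M)) + (μ ^ 2) • (Q', (0 : n ⊕ Fin 2 → M)) =
      cxFive A π v := by
    refine Prod.ext (Subtype.ext ?_) ?_
    · ext l l'
      change (μ ^ 2) • Q'.1 l l' + (μ ^ 2) • Q'.1 l l' =
        sm R M (ee π l') (nn A l i j k • ψ i j k (Q'.1 p p)) +
        sm R M (ee π l) (nn A l' i j k • ψ i j k (Q'.1 p p))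
      rw [map_smul, map_smul, sm_ee_psi hex hπ hψ, sm_ee_psi hex hπ hψ, h2, smul_smul, smul_smul,
        mul_comm (nn A l' i j k)]
    · ext h
      change μ ^ 2 • (0 : M) + μ ^ 2 • (0 : M) = -∑ l, A h l • nn A l i j k • ψ i j k (Q'.1 p p)
      simp only [smul_smul, ← Finset.sum_smul]
      rw [smul_eq_zero_of_mem_mI A hex hπ (sum_nn_mul_mem h i j k)]
      simp
  refine ⟨3, ?_⟩
  have h4 : μ ^ 3 • (Q, w) = μ ^ 2 • (Q', (0 : n ⊕ Fin 2 → M)) + μ ^ 2 • cxFive A π u := by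
    rw [← hQ', smul_sub, smul_smul, ← pow_succ, sub_add_cancel]
  rw [h4]
  refine Submodule.add_mem _ (mem_of_add_self_mem ?_) (Submodule.smul_mem _ _ ⟨u, rfl⟩)
  rw [h3]
  exact ⟨v, rfl⟩

lemma altMul_torsion (Y : Matrix (n ⊕ Fin 2) n (SymPow R M 2)) (hY : altMul A Y = 0)
    (p : n) (i j k : n ⊕ Fin 2) :
    ∃ e, nn A p i j k ^ e • Y ∈ LinearMap.range (cxFour A π) := by
  set μ := nn A p i j k with hμ
  have hout : ∀ y : n ⊕ Fin 2 → SymPow R M 2,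
      (Matrix.of fun h l => nn A l i j k • y h) ∈ LinearMap.range (cxFour A π) := fun y =>
    ⟨(0, fun h => ψ i j k (y h)), by
      rw [cxFour_apply]
      ext h l
      rw [Matrix.add_apply, outer_psi hex hπ hψ]
      change lmul A (0 : Matrix n n (SymPow R M 2)) h l + _ = _
      rw [map_zero, Matrix.zero_apply, zero_add]; rfl⟩
  let Z : Matrix n n (SymPow R M 2) := lmul (NM A p i j k) Y
  have hY' : (lmul A Yᵀ)ᵀ = lmul A Yᵀ := by
    rw [← sub_eq_zero, ← altMul_coe, hY]; rfl
  have h1 : μ • Y = lmul A Zᵀ + Matrix.of fun h l => nn A l i j k • Y h p := by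
    ext h l
    have h2 := lmul_NM_lmul (A := A) p i j k Yᵀ l h
    have h3 : (lmul (NM A p i j k) (lmul A Yᵀ)) = (lmul A Zᵀ)ᵀ := by
      rw [← hY', lmul_transpose_comm]
    rw [h3, Matrix.transpose_apply, Matrix.transpose_apply, Matrix.transpose_apply] at h2
    rw [Matrix.add_apply, h2]
    change μ • Y h l = _ + nn A l i j k • Y h p
    rw [sub_add_cancel]
  set X := Zᵀ with hX
  let V := lmul A (X - Xᵀ)
  have hV : lmul A Vᵀ = 0 := by
    have h2 : altMul A (lmul A X) = 0 := by
      obtain ⟨q, hq⟩ := hout fun h => Y h p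
      have := congrArg (altMul A) h1
      rw [map_smul, hY, smul_zero, map_add, ← hq, altMul_cxFour hex, add_zero] at this
      exact this.symm
    have h3 := congrArg Subtype.val h2
    rw [altMul_coe, ← lmul_transpose_comm] at h3
    have h4 : lmul A Vᵀ = lmul A (lmul A X)ᵀ - lmul A (lmul A Xᵀ)ᵀ := by
      rw [← map_sub, ← Matrix.transpose_sub, ← map_sub]
    rw [h4, ← neg_sub, h3]
    exact neg_zero
  have hV2 : μ • V ∈ LinearMap.range (cxFour A π) := by
    convert hout fun h => V h p using 1
    ext h l
    have h2 := lmul_NM_lmul (A := A) p i j k Vᵀ l h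
    rw [hV, map_zero] at h2
    exact sub_eq_zero.1 h2.symm
  have hS : lmul A (X + Xᵀ) ∈ LinearMap.range (cxFour A π) :=
    ⟨(toSym R _ n X, 0), by rw [cxFour_apply, toSym_coe, map_zero, add_zero]⟩
  refine ⟨2, ?_⟩
  rw [pow_two, mul_smul, h1, smul_add]
  refine Submodule.add_mem _ (mem_of_add_self_mem ?_) (Submodule.smul_mem _ _ (hout _))
  have h5 : μ • lmul A X + μ • lmul A X = μ • lmul A (X + Xᵀ) + μ • V := by
    rw [← smul_add, ← smul_add, ← map_add, ← map_add]
    congr 2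
    abel
  rw [h5]
  exact Submodule.add_mem _ (Submodule.smul_mem _ _ hS) hV2

omit hex hπ hψ in
lemma AltM.eq_of_support_triple {N : Type} [AddCommGroup N] [Module R N]
    (V : AltM R N (n ⊕ Fin 2)) (i j k : n ⊕ Fin 2) (hij : i ≠ j)
    (hjk : j ≠ k) (hki : k ≠ i)
    (hV : ∀ h h', (h ∉ ({i, j, k} : Set (n ⊕ Fin 2)) ∨ h' ∉ ({i, j, k} : Set (n ⊕ Fin 2))) →
      V.1 h h' = 0) : V = toAlt R N _ (Matrix.single i j (V.1 i j) + Matrix.single j k (V.1 j k) +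
        Matrix.single k i (V.1 k i)) := by
  apply Subtype.ext
  rw [toAlt_coe, Matrix.transpose_add, Matrix.transpose_add, Matrix.transpose_single,
    Matrix.transpose_single, Matrix.transpose_single]
  ext a b
  rw [Matrix.sub_apply]
  by_cases ha : a ∈ ({i, j, k} : Set (n ⊕ Fin 2))
  swap
  · rw [hV a b (Or.inl ha)]
    simp only [Set.mem_insert_iff, Set.mem_singleton_iff, not_or] at ha
    simp [Ne.symm ha.1, Ne.symm ha.2.1, Ne.symm ha.2.2]
  by_cases hb : b ∈ ({i, j, k} : Set (n ⊕ Fin 2))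
  swap
  · rw [hV a b (Or.inr hb)]
    simp only [Set.mem_insert_iff, Set.mem_singleton_iff, not_or] at hb
    simp [Ne.symm hb.1, Ne.symm hb.2.1, Ne.symm hb.2.2]
  have h1 := AltM.apply_comm V j i
  have h2 := AltM.apply_comm V k j
  have h3 := AltM.apply_comm V i k
  rcases ha with ha | ha | ha <;> rcases hb with hb | hb | hb <;> rw [ha, hb] <;>
    simp [AltM.apply_self V, h1, h2, h3, hij, hjk, hki, hij.symm, hjk.symm, hki.symm]

/-- The three values of `cxTwo` on an alternating matrix supported on three indices. -/
lemma cxTwo_triple (i j k : n ⊕ Fin 2) (a b c : SymPow R M 2) :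
    let u := cxTwo ψ (toAlt R _ _ (Matrix.single i j a + Matrix.single j k b +
      Matrix.single k i c))
    u k = ψ i j k a + ψ i j k a ∧ u i = ψ i j k b + ψ i j k b ∧ u j = ψ i j k c + ψ i j k c := by
  have h13 := psi_self₁₃ hπ hψ
  have h23 := psi_self₂₃ hπ hψ
  have hc := psi_cycle hπ hψ
  intro u
  have hu : ∀ h, u h = ψ i j h a + ψ j k h b + ψ k i h c + (ψ i j h a + ψ j k h b + ψ k i h c) :=
    fun h => by
      rw [← cxTwoAux_single ψ i j h a, ← cxTwoAux_single ψ j k h b, ← cxTwoAux_single ψ k i h c]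
      simp only [u, cxTwo_toAlt hπ hψ, map_add, Pi.add_apply]
  refine ⟨?_, ?_, ?_⟩
  · rw [hu]; simp [h13, h23]
  · rw [hu]; simp [h13, h23, hc]
  · rw [hu]; simp [h13, h23, hc]

lemma cxTwo_torsion (W : AltM R (SymPow R M 2) (n ⊕ Fin 2)) (hW : cxTwo ψ W = 0)
    (p : n) (i j k : n ⊕ Fin 2) (hij : i ≠ j) (hjk : j ≠ k) (hki : k ≠ i) :
    ∃ e, nn A p i j k ^ e • W ∈ LinearMap.range (altMul A (N := SymPow R M 2)) := by
  set μ := nn A p i j k with hμ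
  obtain ⟨Y, hY⟩ := exists_altMul_eq_outside A (NM A p i j k) μ ({i, j, k} : Set (n ⊕ Fin 2))
    (fun h hh h' => by
      simp only [Set.mem_insert_iff, Set.mem_singleton_iff, not_or] at hh
      rw [Matrix.mul_apply]
      exact sum_nn2_mul A p i j k h h' hh.1 hh.2.1 hh.2.2) W
  set V := μ ^ 2 • W - altMul A Y with hVdef
  have hV0 : cxTwo ψ V = 0 := by
    rw [hVdef, map_sub, map_smul, hW, smul_zero, cxTwo_altMul hex hπ hψ, sub_zero]
  have hV := AltM.eq_of_support_triple V i j k hij hjk hki hY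
  obtain ⟨h1, h2, h3⟩ := cxTwo_triple hex hπ hψ i j k (V.1 i j) (V.1 j k) (V.1 k i)
  rw [← hV, hV0] at h1 h2 h3
  have key : ∀ s, (0 : M) = ψ i j k s + ψ i j k s → μ • s = 0 := fun s hs => by
    rw [← sm_ee_psi hex hπ hψ, eq_zero_of_add_self hs.symm R, map_zero]
  have hμV : μ • V = 0 := by
    rw [hV, ← map_smul, smul_add, smul_add, Matrix.smul_single, Matrix.smul_single,
      Matrix.smul_single, key _ h1, key _ h2, key _ h3]
    simp
  refine ⟨3, μ • Y, ?_⟩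
  rw [map_smul, pow_succ', mul_smul, eq_comm, ← sub_eq_zero]
  exact (smul_sub _ _ _).symm.trans hμV

lemma vmul_torsion (z : n ⊕ Fin 2 → M) (hz : vmul Aᵀ z = 0)
    (p : n) (i j k : n ⊕ Fin 2) :
    ∃ e, nn A p i j k ^ e • z ∈ LinearMap.range (cxTwo ψ) := by
  set μ := nn A p i j k with hμ
  obtain ⟨h1, h2, h3⟩ := cxTwo_triple hex hπ hψ i j k (sm R M (ee π p) (z k))
    (sm R M (ee π p) (z i)) (sm R M (ee π p) (z j))
  set W := toAlt R (SymPow R M 2) (n ⊕ Fin 2) (Matrix.single i j (sm R M (ee π p) (z k)) +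
    Matrix.single j k (sm R M (ee π p) (z i)) + Matrix.single k i (sm R M (ee π p) (z j)))
  rw [hψ] at h1 h2 h3
  set x := μ • z + μ • z - cxTwo ψ W with hx
  have hx0 : vmul Aᵀ x = 0 := by
    rw [hx, map_sub, map_add, map_smul, hz, vmul_cxTwo hex hπ hψ]
    simp
  have hxT : x k = 0 ∧ x i = 0 ∧ x j = 0 := by
    refine ⟨?_, ?_, ?_⟩ <;> simp [hx, h1, h2, h3, hμ]
  have hxμ : μ • x = 0 := by
    ext h'
    have h4 : ∑ h, (A * NM A p i j k) h h' • x h = 0 := by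
      simp only [Matrix.mul_apply, Finset.sum_smul]
      rw [Finset.sum_comm]
      refine Finset.sum_eq_zero fun l _ => ?_
      have h5 : ∑ h, A h l • x h = 0 := congrFun hx0 l
      rw [← smul_zero (NM A p i j k l h'), ← h5, Finset.smul_sum]
      exact Finset.sum_congr rfl fun h _ => by rw [smul_smul, mul_comm]
    have h6 : ∀ h, (A * NM A p i j k) h h' • x h = if h = h' then μ • x h else 0 := fun h => by
      by_cases hi : h = i
      · rw [hi, hxT.2.1]; simp
      by_cases hj : h = j
      · rw [hj, hxT.2.2]; simp
      by_cases hk : h = k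
      · rw [hk, hxT.1]; simp
      have := sum_nn2_mul A p i j k h h' hi hj hk
      rw [← ite_zero_smul, ← this, Matrix.mul_apply]; rfl
    rw [Finset.sum_congr rfl fun h _ => h6 h] at h4
    simpa using h4
  refine ⟨2, mem_of_add_self_mem ⟨μ • W, ?_⟩⟩
  rw [map_smul, ← sub_eq_zero, ← neg_eq_zero, ← hxμ, hx, smul_sub, smul_add, smul_smul, ← pow_two,
    neg_sub]

end Torsion

section Acyclic

variable {R : Type} [CommRing R] [IsNoetherianRing R] {M : Type} [AddCommGroup M] [Module R M]
  {n : Type} [Fintype n] [DecidableEq n]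
  {A : Matrix (n ⊕ Fin 2) n R} {π : (n → R) →ₗ[R] M}
  {ψ : n ⊕ Fin 2 → n ⊕ Fin 2 → n ⊕ Fin 2 → SymPow R M 2 →ₗ[R] M}
  [Invertible (2 : R)]

variable (A) in
/-- The ideal of minors of `A` of corank one, generated by the values of `nn`. -/
def nI : Ideal R :=
  Ideal.span (Set.range fun p : n × (n ⊕ Fin 2) × (n ⊕ Fin 2) × (n ⊕ Fin 2) =>
    nn A p.1 p.2.1 p.2.2.1 p.2.2.2)

/-- The complex `cxFive`, `cxFour`, `altMul`, `cxTwo`, `vmul` is exact from `altMul` on. -/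
lemma cx_exact (hex : Function.Exact Aᵀ.mulVecLin π) (hπ : Function.Surjective π)
    (hψ : ∀ i j k l x, ψ i j k (sm R M (ee π l) x) = nn A l i j k • x)
    (h3 : Dep (mI A) 3 R) (h8 : Dep (nI A) 8 R) :
    Function.Exact (altMul A (N := SymPow R M 2)) (cxTwo ψ) ∧
      Function.Exact (cxTwo ψ) (vmul Aᵀ) := by
  have hM : Dep (nI A) 5 M := dep_cokernel hex hπ h3 h8
  have hS : Dep (nI A) 5 (SymPow R M 2) := dep_symPow hex hπ h3 h8
  have e5 := Dep.acyclic_start (J := nI A) (d := 4) rfl (g := cxFive A π)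
    ((hS.mono (by lia)).sym.prod (hM.mono (by lia)).pi) hM.pi (by
      rintro u hu _ ⟨⟨p, i, j, k⟩, rfl⟩
      exact cxFive_torsion hex hπ hψ u hu p i j k)
  have e4 := Dep.acyclic_step (J := nI A) (d := 3) (f := cxFive A π) (g := cxFour A π) rfl
    (cxFour_cxFive hex)
    (hS.mono (by lia)).matrix e5.2 (by
      rintro z hz _ ⟨⟨p, i, j, k⟩, rfl⟩
      exact cxFour_torsion hex hπ hψ z hz p i j k)
  have e3 := Dep.acyclic_step (J := nI A) (d := 2) (f := cxFour A π)
    (g := altMul A (N := SymPow R M 2)) rfl (altMul_cxFour hex)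
    (hS.mono (by lia)).alt e4.2 (by
      rintro z hz _ ⟨⟨p, i, j, k⟩, rfl⟩
      exact altMul_torsion hex hπ hψ z hz p i j k)
  have e2 := Dep.acyclic_step (J := nI A) (d := 1) (f := altMul A (N := SymPow R M 2))
    (g := cxTwo ψ) rfl (cxTwo_altMul hex hπ hψ)
    (hM.mono (by lia)).pi e3.2 (by
      rintro z hz _ ⟨⟨p, i, j, k⟩, rfl⟩
      by_cases hij : i = j
      · subst hij
        exact ⟨1, by simp [nn_self₁₂]⟩
      by_cases hjk : j = k
      · subst hjk
        exact ⟨1, by simp [nn_self₂₃]⟩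
      by_cases hki : k = i
      · subst hki
        exact ⟨1, by simp [nn_self₁₃]⟩
      exact cxTwo_torsion hex hπ hψ z hz p i j k hij hjk hki)
  refine ⟨e2.1, Dep.exact_of_torsion (J := nI A) (f := cxTwo ψ)
    (g := vmul Aᵀ) rfl (vmul_cxTwo hex hπ hψ) e2.2 ?_⟩
  rintro z hz _ ⟨⟨p, i, j, k⟩, rfl⟩
  exact vmul_torsion hex hπ hψ z hz p i j k

end Acyclic

section TorSide

variable {R : Type} [CommRing R] {n : Type} [Fintype n] [DecidableEq n]
  {A : Matrix (n ⊕ Fin 2) n R} {N : Type} [AddCommGroup N] [Module R N]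

variable (R N) in
/-- The alternating matrix `(W i j • x)`. -/
def altSmul (a : Type) : AltM R R a →ₗ[R] N →ₗ[R] AltM R N a :=
  LinearMap.mk₂ R (fun W x => ⟨Matrix.of fun i j => W.1 i j • x, by
      ext i j
      change W.1 j i • x = -(W.1 i j • x)
      rw [AltM.apply_comm W j i, neg_smul]⟩)
    (fun W W' x => by ext i j; exact add_smul _ _ _)
    (fun r W x => by ext i j; exact mul_smul _ _ _)
    (fun W x y => by ext i j; exact smul_add _ _ _)
    (fun r W x => by ext i j; exact smul_comm _ _ _)

omit [DecidableEq n] in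
lemma altSmul_altMul (Y : Matrix (n ⊕ Fin 2) n R) (x : N) :
    altSmul R N _ (altMul A Y) x = altMul A (Matrix.of fun i j => Y i j • x) := by
  ext i j
  change (altMul A Y).1 i j • x = (altMul A (Matrix.of fun i j => Y i j • x)).1 i j
  rw [altMul_coe, altMul_coe]
  simp [lmul_apply, sub_smul, Finset.sum_smul, smul_smul]

lemma altSmul_toAlt_single {a : Type} [DecidableEq a] (i j : a) (x : N) :
    altSmul R N a (toAlt R R a (Matrix.single i j 1)) x = toAlt R N a (Matrix.single i j x) := by
  ext h h'
  change (toAlt R R a (Matrix.single i j 1)).1 h h' • x = (toAlt R N a (Matrix.single i j x)).1 h h'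
  rw [toAlt_coe, toAlt_coe]
  simp [Matrix.single_apply, sub_smul, ite_smul]

variable [Invertible (2 : R)] [IsNoetherianRing R]

variable (A N) in
/-- The restriction of `pairSum` to alternating matrices. -/
def pairAlt : AltM R N (n ⊕ Fin 2) →ₗ[R] N ⊗[R] mI A :=
  pairSum A ∘ₗ (AltM R N (n ⊕ Fin 2)).subtype

omit [Invertible (2 : R)] [IsNoetherianRing R] in
lemma pairAlt_toAlt (W : Matrix (n ⊕ Fin 2) (n ⊕ Fin 2) N) :
    pairAlt A N (toAlt R N _ W) = pairSum A W + pairSum A W := by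
  change pairSum A (W - Wᵀ) = _
  rw [map_sub, pairSum_transpose, sub_neg_eq_add]

lemma pairAlt_exact (h3 : Dep (mI A) 3 R) :
    Function.Exact (altMul A (N := N)) (pairAlt A N) := by
  let q := (LinearMap.range (altMul A (N := N))).mkQ
  obtain ⟨g, hg⟩ := exists_descend (altSum_surjective A)
    ((LinearMap.compr₂ (altSmul R N (n ⊕ Fin 2)) q)) fun W hW => by
      obtain ⟨Y, rfl⟩ := (altSum_exact A h3 W).1 hW
      ext x
      rw [LinearMap.compr₂_apply, altSmul_altMul]
      exact (Submodule.Quotient.mk_eq_zero _).2 ⟨_, rfl⟩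
  have key : (TensorProduct.lift g.flip ∘ₗ pairAlt A N) ∘ₗ toAlt R N (n ⊕ Fin 2) =
      q ∘ₗ toAlt R N (n ⊕ Fin 2) := by
    refine Matrix.ext_linearMap R fun i j => LinearMap.ext fun x => ?_
    change TensorProduct.lift g.flip (pairAlt A N (toAlt R N _ (Matrix.single i j x))) =
      q (toAlt R N _ (Matrix.single i j x))
    have h1 : altSum A (toAlt R R _ (Matrix.single i j 1)) = qq A i j + qq A i j := by
      change TensorProduct.lid R _ (pairAlt A R _) = _
      rw [pairAlt_toAlt, pairSum_single]
      simp
    rw [pairAlt_toAlt, pairSum_single, ← TensorProduct.tmul_add, ← h1, TensorProduct.lift.tmul,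
      LinearMap.flip_apply, hg, LinearMap.compr₂_apply, altSmul_toAlt_single]
  intro W
  refine ⟨fun hW => ?_, ?_⟩
  · have h1 : toAlt R N (n ⊕ Fin 2) ((⅟2 : R) • W.1) = W := LinearMap.congr_fun toAlt_half W
    have h2 := LinearMap.congr_fun key ((⅟2 : R) • W.1)
    simp only [LinearMap.comp_apply] at h2
    rw [h1, hW, map_zero] at h2
    exact (Submodule.Quotient.mk_eq_zero _).1 h2.symm
  · rintro ⟨Y, rfl⟩
    exact pairSum_altMul A Y

omit [IsNoetherianRing R] in
lemma pairAlt_surjective : Function.Surjective (pairAlt A N) := pairSum_alt_surjective A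

variable {M : Type} [AddCommGroup M] [Module R M]

omit [Invertible (2 : R)] [IsNoetherianRing R] in
lemma lTensor_mulVecLin_eq_zero {a b : Type} [Fintype a] [Fintype b] [DecidableEq a]
    {I : Ideal R} (hI : ∀ r ∈ I, ∀ x : M, r • x = 0) (B : Matrix a b R)
    (hB : ∀ i j, B i j ∈ I) : LinearMap.lTensor M B.mulVecLin = 0 := by
  refine TensorProduct.ext' fun x y => ?_
  rw [LinearMap.lTensor_tmul, LinearMap.zero_apply, Matrix.mulVecLin_apply,
    ← Finset.univ_sum_single (B *ᵥ y), TensorProduct.tmul_sum]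
  refine Finset.sum_eq_zero fun i _ => ?_
  have h : (B *ᵥ y) i ∈ I := by
    rw [Matrix.mulVec, dotProduct]
    exact I.sum_mem fun j _ => I.mul_mem_right _ (hB i j)
  have h1 : Pi.single i ((B *ᵥ y) i) = (B *ᵥ y) i • (Pi.single i 1 : a → R) := by
    rw [← Pi.single_smul, smul_eq_mul, mul_one]
  rw [h1, ← TensorProduct.smul_tmul, hI _ h, TensorProduct.zero_tmul]

omit [Invertible (2 : R)] [IsNoetherianRing R] in
lemma vmul_piScalarRight {a b : Type} [Fintype a] [Fintype b] [DecidableEq a] [DecidableEq b]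
    (B : Matrix a b R) (z : M ⊗[R] (b → R)) :
    vmul B (TensorProduct.piScalarRight R R M b z) =
      TensorProduct.piScalarRight R R M a (LinearMap.lTensor M B.mulVecLin z) := by
  induction z using TensorProduct.induction_on with
  | zero => simp
  | add x y hx hy => simp only [map_add, hx, hy]
  | tmul x y =>
    ext i
    simp [vmul_apply, TensorProduct.piScalarRight_apply, Matrix.mulVec, dotProduct,
      Finset.sum_smul, smul_smul]

/-- The kernel of `lTensor M B` for a matrix `B`. -/
def kerLTensorEquiv (M : Type) [AddCommGroup M] [Module R M] {a b : Type} [Fintype a] [Fintype b]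
    [DecidableEq a] [DecidableEq b] (B : Matrix a b R) :
    LinearMap.ker (LinearMap.lTensor M B.mulVecLin) ≃ₗ[R] LinearMap.ker (vmul B (M := M)) :=
  (TensorProduct.piScalarRight R R M b).ofSubmodules _ _ <| by
    ext z
    rw [Submodule.mem_map]
    constructor
    · rintro ⟨z, hz, rfl⟩
      exact (vmul_piScalarRight B z).trans (by rw [LinearMap.mem_ker.1 hz, map_zero])
    · intro hz
      refine ⟨(TensorProduct.piScalarRight R R M b).symm z, ?_, by simp⟩
      rw [LinearMap.mem_ker, ← (TensorProduct.piScalarRight R R M a).map_eq_zero_iff,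
        ← vmul_piScalarRight, LinearEquiv.apply_symm_apply]
      exact hz

omit [Invertible (2 : R)] [IsNoetherianRing R] in
/-- Two exact sequences with the same left part have isomorphic third terms. -/
lemma nonempty_equiv_ker {X Y Z V U : Type} [AddCommGroup X] [Module R X] [AddCommGroup Y]
    [Module R Y] [AddCommGroup Z] [Module R Z] [AddCommGroup V] [Module R V] [AddCommGroup U]
    [Module R U] {f : X →ₗ[R] Y} {g : Y →ₗ[R] Z} {g' : Y →ₗ[R] V} {h : V →ₗ[R] U}
    (hfg : Function.Exact f g) (hg : Function.Surjective g) (hfg' : Function.Exact f g')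
    (hg' : Function.Exact g' h) : Nonempty (Z ≃ₗ[R] LinearMap.ker h) := by
  have h1 : LinearMap.ker g = LinearMap.ker g' :=
    (LinearMap.exact_iff.1 hfg).trans (LinearMap.exact_iff.1 hfg').symm
  exact ⟨(g.quotKerEquivOfSurjective hg).symm ≪≫ₗ Submodule.quotEquivOfEq _ _ h1 ≪≫ₗ
    g'.quotKerEquivRange ≪≫ₗ LinearEquiv.ofEq _ _ (LinearMap.exact_iff.1 hg').symm⟩

variable {π : (n → R) →ₗ[R] M}

lemma tor_iso (hex : Function.Exact Aᵀ.mulVecLin π) (hπ : Function.Surjective π)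
    (h3 : Dep (mI A) 3 R) (h8 : Dep (nI A) 8 R) :
    misoM (TorM R 1 M M) (ModuleCat.of R (SymPow R M 2 ⊗[R] mI A)) := by
  choose ψ hψ using exists_psi A hex hπ
  obtain ⟨he, he'⟩ := cx_exact hex hπ hψ h3 h8
  obtain ⟨e⟩ := nonempty_equiv_ker (f := altMul A (N := SymPow R M 2))
    (g := pairAlt A (SymPow R M 2))
    (g' := cxTwo ψ) (h := vmul Aᵀ) (pairAlt_exact h3) pairAlt_surjective he he'
  have hX : LinearMap.lTensor M (PM A).mulVecLin = 0 :=
    lTensor_mulVecLin_eq_zero (I := mI A) (fun r hr x => smul_eq_zero_of_mem_mI A hex hπ hr x)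
      (PM A) fun i j => Ideal.subset_span ⟨(i, j), rfl⟩
  obtain ⟨e'⟩ := tor_one_iso _ _ π hπ hex (transpose_exact A h3) M hX
  exact ⟨e' ≪≫ (kerLTensorEquiv M Aᵀ ≪≫ₗ e.symm).toModuleIso⟩

end TorSide

section ExtSide

variable {R : Type} [CommRing R] {n : Type} [Fintype n] [DecidableEq n]
  {A : Matrix (n ⊕ Fin 2) n R} (N : Type) [AddCommGroup N] [Module R N]
  {M : Type} [AddCommGroup M] [Module R M] (π : (n → R) →ₗ[R] M)

variable (R n) in
/-- The bilinear map sending `x` and `y` to the functional `Q ↦ xᵀ Q y`. -/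
def symForm : (n → R) →ₗ[R] (n → R) →ₗ[R] SymM R R n →ₗ[R] R :=
  LinearMap.mk₂ R (fun x y =>
    { toFun Q := x ⬝ᵥ Q.1 *ᵥ y
      map_add' P Q := by
        change x ⬝ᵥ (P.1 + Q.1) *ᵥ y = _
        rw [Matrix.add_mulVec, dotProduct_add]
      map_smul' r Q := by
        change x ⬝ᵥ (r • Q.1) *ᵥ y = _
        rw [Matrix.smul_mulVec, dotProduct_smul]; rfl })
    (fun _ _ _ => LinearMap.ext fun _ => add_dotProduct _ _ _)
    (fun _ _ _ => LinearMap.ext fun _ => smul_dotProduct _ _ _)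
    (fun _ _ _ => LinearMap.ext fun _ => by simp [Matrix.mulVec_add])
    (fun _ _ _ => LinearMap.ext fun _ => by simp [Matrix.mulVec_smul])

omit [DecidableEq n] in
lemma symForm_apply (x y : n → R) (Q : SymM R R n) : symForm R n x y Q = x ⬝ᵥ Q.1 *ᵥ y := rfl

lemma symForm_single (l l' : n) (Q : SymM R R n) :
    symForm R n (Pi.single l 1) (Pi.single l' 1) Q = Q.1 l l' := by
  simp [symForm_apply]

omit [DecidableEq n] in
lemma symForm_comm (x y : n → R) : symForm R n x y = symForm R n y x := by
  ext Q
  rw [symForm_apply, symForm_apply, Matrix.dotProduct_mulVec, dotProduct_comm,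
    ← Matrix.mulVec_transpose, mem_SymM.1 Q.2]

/-- The map `f ↦ ∑ e_i e_j ⊗ f (E_{i, j} + E_{j, i})`. -/
def homKap : (SymM R R n →ₗ[R] N) →ₗ[R] SymPow R M 2 ⊗[R] N where
  toFun f := ∑ l, ∑ l', sm R M (ee π l) (ee π l') ⊗ₜ f (toSym R R n (Matrix.single l l' 1))
  map_add' f g := by simp [TensorProduct.tmul_add, Finset.sum_add_distrib]
  map_smul' r f := by simp [Finset.smul_sum]

lemma homKap_apply (f : SymM R R n →ₗ[R] N) :
    homKap N π f =
      ∑ l, ∑ l', sm R M (ee π l) (ee π l') ⊗ₜ f (toSym R R n (Matrix.single l l' 1)) := rfl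

variable {π} (hex : Function.Exact Aᵀ.mulVecLin π) (hπ : Function.Surjective π)

include hex in
lemma homKap_lcomp (g : Matrix (n ⊕ Fin 2) n R →ₗ[R] N) :
    homKap N π (LinearMap.lcomp R N (symMul A) g) = 0 := by
  have h1 : ∀ l l', LinearMap.lcomp R N (symMul A) g (toSym R R n (Matrix.single l l' 1)) =
      g (A * Matrix.single l l' (1 : R)) + g (A * Matrix.single l' l (1 : R)) := fun l l' => by
    rw [← map_add, ← Matrix.mul_add, ← Matrix.transpose_single l l' (1 : R)]
    rfl
  have h2 : ∀ l', ∑ l, sm R M (ee π l) (ee π l') ⊗ₜ[R] g (A * Matrix.single l l' (1 : R)) = 0 := by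
    intro l'
    have h3 : ∀ l, A * Matrix.single l l' (1 : R) = ∑ h, A h l • Matrix.single h l' (1 : R) := by
      intro l
      ext i j
      simp [Matrix.sum_apply, Matrix.mul_apply, Matrix.single_apply, ite_and]
    simp only [h3, map_sum, map_smul, TensorProduct.tmul_sum]
    rw [Finset.sum_comm]
    refine Finset.sum_eq_zero fun h _ => ?_
    simp only [← TensorProduct.smul_tmul, ← LinearMap.map_smul₂]
    rw [← TensorProduct.sum_tmul, ← LinearMap.sum_apply, ← map_sum, sum_smul_ee A hex, map_zero,
      LinearMap.zero_apply, TensorProduct.zero_tmul]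
  rw [homKap_apply]
  simp only [h1, TensorProduct.tmul_add, Finset.sum_add_distrib]
  rw [Finset.sum_comm, Finset.sum_eq_zero fun l' _ => h2 l', zero_add]
  refine Finset.sum_eq_zero fun l _ => ?_
  simp only [sm_comm (ee π l)]
  exact h2 l

variable [Invertible (2 : R)]

include hπ in
lemma homKap_surjective : Function.Surjective (homKap (R := R) N π) := by
  have h1 : ∀ a b v, sm R M (ee π a) (ee π b) ⊗ₜ[R] v ∈ LinearMap.range (homKap (R := R) N π) := by
    intro a b v
    refine mem_of_add_self_mem
      ⟨(symForm R n (Pi.single a 1) (Pi.single b 1)).smulRight v, ?_⟩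
    rw [homKap_apply]
    simp only [LinearMap.smulRight_apply, symForm_single, toSym_coe, Matrix.add_apply,
      Matrix.transpose_apply, Matrix.single_apply, ite_and, add_smul, ite_smul, one_smul, zero_smul,
      TensorProduct.tmul_add, Finset.sum_add_distrib]
    congr 1
    · rw [Finset.sum_eq_single a, Finset.sum_eq_single b] <;> simp +contextual
    · rw [Finset.sum_eq_single b, Finset.sum_eq_single a, sm_comm] <;> simp +contextual
  rw [← LinearMap.range_eq_top, eq_top_iff, ← TensorProduct.span_tmul_eq_top, Submodule.span_le]
  rintro _ ⟨s, v, rfl⟩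
  have h2 : ((LinearMap.range (homKap (R := R) N π)).mkQ ∘ₗ
      (TensorProduct.mk R (SymPow R M 2) N).flip v) = 0 := by
    refine sm_ee_hom_ext hπ fun l x => ?_
    obtain ⟨x, rfl⟩ := hπ x
    rw [apply_eq_sum_ee, map_sum, map_sum, map_sum]
    refine Finset.sum_congr rfl fun l' _ => ?_
    rw [map_smul, map_smul, map_smul]
    congr 1
    exact (Submodule.Quotient.mk_eq_zero _).2 (h1 _ _ _)
  exact (Submodule.Quotient.mk_eq_zero _).1 (LinearMap.congr_fun h2 s)

include hex hπ in
lemma homKap_exact :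
    Function.Exact (LinearMap.lcomp R N (symMul A)) (homKap (R := R) N π) := by
  let P := LinearMap.range (LinearMap.lcomp R N (symMul A (N := R)))
  let β : (n → R) →ₗ[R] (n → R) →ₗ[R] N →ₗ[R] ((SymM R R n →ₗ[R] N) ⧸ P) :=
    (symForm R n).compr₂ (LinearMap.compRight R P.mkQ ∘ₗ LinearMap.smulRightₗ)
  have hβ : ∀ x y v, β x y v = P.mkQ ((symForm R n x y).smulRight v) := fun x y v => rfl
  have hβc : ∀ x y, β x y = β y x := fun x y => LinearMap.ext fun v => by
    rw [hβ, hβ, symForm_comm]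
  have hβ0 : ∀ x y, π x = 0 → β x y = 0 := fun x y hx => LinearMap.ext fun v => by
    obtain ⟨u, rfl⟩ := (hex x).1 hx
    refine (Submodule.Quotient.mk_eq_zero _).2 ⟨LinearMap.smulRight
      { toFun Z := u ⬝ᵥ Z *ᵥ y
        map_add' Z Z' := by rw [Matrix.add_mulVec, dotProduct_add]
        map_smul' r Z := by rw [Matrix.smul_mulVec, dotProduct_smul]; rfl } v, ?_⟩
    ext Q
    change (u ⬝ᵥ (A * Q.1) *ᵥ y) • v = ((Aᵀ *ᵥ u) ⬝ᵥ Q.1 *ᵥ y) • v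
    rw [← Matrix.mulVec_mulVec, Matrix.dotProduct_mulVec, Matrix.mulVec_transpose]
  obtain ⟨γ, hγ⟩ := exists_descend₂ hπ β hβ0 fun x y hy => by rw [hβc, hβ0 y x hy]
  obtain ⟨Γ, hΓ⟩ := exists_sm_lift γ fun x y => by
    obtain ⟨x, rfl⟩ := hπ x
    obtain ⟨y, rfl⟩ := hπ y
    rw [hγ, hγ, hβc]
  have key : ∀ f, TensorProduct.lift Γ (homKap N π f) = P.mkQ (f + f) := fun f => by
    rw [homKap_apply]
    simp only [map_sum, TensorProduct.lift.tmul, ee, hΓ, hγ, hβ]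
    simp only [← map_sum]
    congr 1
    ext Q
    simp only [LinearMap.sum_apply, LinearMap.smulRight_apply, symForm_single, LinearMap.add_apply,
      ← map_smul, ← map_sum]
    rw [← map_add]
    congr 1
    have hQ : toSym R R n Q.1 = Q + Q := Subtype.ext (by rw [toSym_coe, mem_SymM.1 Q.2]; rfl)
    rw [← hQ]
    congr 1
    conv_rhs => rw [Matrix.matrix_eq_sum_single Q.1]
    simp [Matrix.smul_single]
  intro f
  refine ⟨fun hf => mem_of_add_self_mem (R := R) (P := P) ?_, ?_⟩
  · rw [← Submodule.Quotient.mk_eq_zero]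
    exact (key f).symm.trans (by rw [hf, map_zero])
  · rintro ⟨g, rfl⟩
    exact homKap_lcomp N hex g

lemma ext_iso [IsNoetherianRing R] (h3 : Dep (mI A) 3 R) (hex : Function.Exact Aᵀ.mulVecLin π)
    (hπ : Function.Surjective π) :
    misoM (ExtM R 2 (mI A) (mI A)) (ModuleCat.of R (SymPow R M 2 ⊗[R] mI A)) := by
  obtain ⟨e⟩ := ext_two_iso (symMul A (N := R)) (altMul A) (altSum A) (altSum_surjective A)
    (altSum_exact A h3) (altMul_exact_and_dep A h3).1 (symMul_injective_and_dep A h3).1 (mI A)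
  exact ⟨e ≪≫ (Submodule.quotEquivOfEq _ _ (LinearMap.exact_iff.1 (homKap_exact _ hex hπ)).symm ≪≫ₗ
    (homKap (mI A) π).quotKerEquivOfSurjective (homKap_surjective _ hπ)).toModuleIso⟩

end ExtSide

section Minors

variable {k : Type} [Field k] {n t : ℕ}

/-- `A` with its rows indexed by a sum type. -/
def splitRows (A : Matrix (Fin (t + 1 + 2)) (Fin (t + 1)) (RR k n)) :
    Matrix (Fin (t + 1) ⊕ Fin 2) (Fin (t + 1)) (RR k n) :=
  A.submatrix finSumFinEquiv id

variable (A : Matrix (Fin (t + 1 + 2)) (Fin (t + 1)) (RR k n))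

lemma minors_eq_mI : minors A (t + 1) = mI (splitRows A) := by
  refine le_antisymm (Ideal.span_le.2 ?_) (Ideal.span_le.2 ?_)
  · rintro _ ⟨r, c, hr, hc, rfl⟩
    have h := det_submatrix_mem_of_mm (splitRows A) (mI (splitRows A))
      (fun i j => Ideal.subset_span ⟨(i, j), rfl⟩) (finSumFinEquiv.symm ∘ r) c
      (finSumFinEquiv.symm.injective.comp hr) hc
    simpa [splitRows, Matrix.submatrix_submatrix, ← Function.comp_assoc] using h
  · rintro _ ⟨p, rfl⟩
    exact mm_mem_span _ _ _ _ fun r hr => Ideal.subset_span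
      ⟨finSumFinEquiv ∘ r, id, finSumFinEquiv.injective.comp hr, Function.injective_id, rfl⟩

lemma minors_eq_nI : minors A t = nI (splitRows A) := by
  refine le_antisymm (Ideal.span_le.2 ?_) (Ideal.span_le.2 ?_)
  · rintro _ ⟨r, c, hr, hc, rfl⟩
    have h := det_submatrix_mem_of_nn (splitRows A) (nI (splitRows A))
      (fun l i j k => Ideal.subset_span ⟨(l, i, j, k), rfl⟩) (finSumFinEquiv.symm ∘ r) c
      (finSumFinEquiv.symm.injective.comp hr) hc
    simpa [splitRows, Matrix.submatrix_submatrix, ← Function.comp_assoc] using h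
  · rintro _ ⟨p, rfl⟩
    exact nn_mem_span _ _ _ _ _ _ fun r c hr hc => Ideal.subset_span
      ⟨finSumFinEquiv ∘ r, c, finSumFinEquiv.injective.comp hr, hc, rfl⟩

lemma mI_le_nI : mI (splitRows A) ≤ nI (splitRows A) := by
  refine Ideal.span_le.2 ?_
  rintro _ ⟨p, rfl⟩
  have h := sum_mul_nn (splitRows A) 0 0 p.1 p.2
  rw [if_pos rfl] at h
  change mm _ _ _ ∈ _
  rw [← h]
  exact Ideal.sum_mem _ fun i _ => Ideal.mul_mem_left _ _
    (Ideal.subset_span ⟨(0, p.1, p.2, i), rfl⟩)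

lemma exact_mkQ : Function.Exact (splitRows A)ᵀ.mulVecLin
    (Submodule.mkQ (LinearMap.range (phiStar A))) := by
  rw [LinearMap.exact_iff, Submodule.ker_mkQ]
  have h : phiStar A = (splitRows A)ᵀ.mulVecLin ∘ₗ
      (LinearEquiv.funCongrLeft (RR k n) (RR k n) finSumFinEquiv).toLinearMap := by
    refine LinearMap.ext fun v => funext fun i => ?_
    change ∑ j, A j i * v j = ∑ j, A (finSumFinEquiv j) i * v (finSumFinEquiv j)
    exact (Equiv.sum_comp finSumFinEquiv fun j => A j i * v j).symm
  rw [h, LinearMap.range_comp_of_range_eq_top _ (LinearEquiv.range _)]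

lemma not_depthGE_quotient_minors_zero (A : Matrix (Fin (0 + 2)) (Fin 0) (RR k n))
    (J : Ideal (RR k n)) (d : ℕ) : ¬ depthGE J (RR k n ⧸ minors A 0) d := by
  rintro ⟨rs, -, -, h⟩
  have h1 : minors A 0 = ⊤ := (Ideal.eq_top_iff_one _).2 (Ideal.subset_span
    ⟨Fin.elim0, Fin.elim0, Function.injective_of_subsingleton _,
      Function.injective_of_subsingleton _, (Matrix.det_isEmpty).symm⟩)
  have : Subsingleton (RR k n ⧸ minors A 0) := Ideal.Quotient.subsingleton_iff.2 h1
  exact h.top_ne_smul (Subsingleton.elim _ _)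

lemma depthGE.mono_ideal {R : Type} [CommRing R] {I J : Ideal R} (hIJ : I ≤ J) {N : Type}
    [AddCommGroup N] [Module R N] {d : ℕ} (h : depthGE I N d) : depthGE J N d :=
  let ⟨rs, h1, h2, h3⟩ := h
  ⟨rs, h1, fun x hx => hIJ (h2 x hx), h3⟩

end Minors

end KMR

namespace KMR


/-- Lemma `lem3`(ii); c = 3.
If `B_t = R/I_t(φ)` is standard determinantal of codimension `3`, `J = I_{t-1}(φ)` and
`depth_J B_t ≥ 5`, then `Tor₁^R(M, M) ≅ S₂M ⊗_R I_t(φ) ≅ Ext²_R(I_t(φ), I_t(φ))(-ℓ₃)`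
(the twist being invisible on underlying modules). -/
theorem statement_9 {k : Type} [Field k] [IsAlgClosed k] [CharZero k]
    {n t : ℕ}
    (A : Matrix (Fin (t + 2)) (Fin t) (RR k n))
    (a : Fin (t + 2) → ℤ) (b : Fin t → ℤ)
    (hhom : IsHomogMatrix A a b)
    (hdet : depthEQ (minors A t) (RR k n) 3)
    (hdepth : depthGE (minors A (t - 1)) (RR k n ⧸ minors A t) 5) :
    misoM (TorM (RR k n) 1 (Mdl A) (Mdl A))
      (ModuleCat.of (RR k n)
        ((SymPow (RR k n) (Mdl A) 2) ⊗[RR k n] ↥(minors A t))) ∧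
    misoM (TorM (RR k n) 1 (Mdl A) (Mdl A))
      (ExtM (RR k n) 2 ↥(minors A t) ↥(minors A t)) := by
  obtain _ | t := t
  · exact (not_depthGE_quotient_minors_zero A _ _ hdepth).elim
  let : Invertible (2 : RR k n) :=
    (invertibleOfNonzero (two_ne_zero (α := k))).map MvPolynomial.C |>.copy _ (map_ofNat _ 2).symm
  rw [Nat.add_sub_cancel, minors_eq_mI, minors_eq_nI] at hdepth
  have hd := hdet.1
  rw [minors_eq_mI] at hd ⊢
  have h3 := Dep.of_depthGE hd
  have h8 : Dep (nI (splitRows A)) 8 (RR k n) :=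
    dep_eight _ (mI_le_nI A) h3 (Dep.of_depthGE (hd.mono_ideal (mI_le_nI A)))
      (Dep.of_depthGE hdepth)
  obtain ⟨e⟩ := tor_iso (exact_mkQ A) (Submodule.mkQ_surjective _) h3 h8
  obtain ⟨e'⟩ := ext_iso h3 (exact_mkQ A) (Submodule.mkQ_surjective _)
  exact ⟨⟨e⟩, ⟨e ≪≫ e'.symm⟩⟩

end KMR
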